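/- arXiv:1509.00917 — 3 statements merged into one kernel-verified Lean document; each statement's English description precedes it below -/
import Mathlib

section
/- Strict decay of the energy (rigidity): if u is a classical solution of the degenerately damped wave equation on [0,T] and E_u(a) = E_u(b) for some 0 ≤ a < b ≤ T, then u(t,x) = 0 for all (t,x) ∈ [a,b] × [0,1]; consequently E_u vanishes on [a,b], and E_u is strictly decreasing on any interval on which it is positive. -/
open MeasureTheory Real Set

/-- The partial derivative in time of a function `u(t,x)`. -/
noncomputable def pdt (u : ℝ → ℝ → ℝ) : ℝ → ℝ → ℝ := fun t x => deriv (fun s => u s x) t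

/-- The partial derivative in space of a function `u(t,x)`. -/
noncomputable def pdx (u : ℝ → ℝ → ℝ) : ℝ → ℝ → ℝ := fun t x => deriv (fun y => u t y) x

/-- A classical (C²) solution of the degenerately damped wave equation
`∂ₜ²u - ∂ₓ²u + α u^(2m) ∂ₜu = 0` on `[0,T] × [0,1]` with homogeneous Dirichlet
boundary conditions. -/
def IsClassicalSolution (α : ℝ) (m : ℕ) (T : ℝ) (u : ℝ → ℝ → ℝ) : Prop :=
  ContDiff ℝ 2 (Function.uncurry u) ∧
  (∀ t ∈ Icc (0:ℝ) T, ∀ x ∈ Icc (0:ℝ) 1,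
    pdt (pdt u) t x - pdx (pdx u) t x + α * (u t x) ^ (2*m) * pdt u t x = 0) ∧
  (∀ t ∈ Icc (0:ℝ) T, u t 0 = 0 ∧ u t 1 = 0)

/-- The energy `E_u(t) = ½∫₀¹ (∂ₓu)² + ½∫₀¹ (∂ₜu)²`. -/
noncomputable def energy (u : ℝ → ℝ → ℝ) (t : ℝ) : ℝ :=
  (1/2) * (∫ x in (0:ℝ)..1, (pdx u t x)^2) + (1/2) * (∫ x in (0:ℝ)..1, (pdt u t x)^2)

section PartialDerivatives

variable {v : ℝ → ℝ → ℝ}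

theorem hasDerivAt_slice_left {t x : ℝ} (hv : DifferentiableAt ℝ (Function.uncurry v) (t, x)) :
    HasDerivAt (fun s => v s x) (fderiv ℝ (Function.uncurry v) (t, x) (1, 0)) t :=
  hv.hasFDerivAt.comp_hasDerivAt (f := fun s => (s, x)) t
    ((hasDerivAt_id t).prodMk (hasDerivAt_const t x))

theorem hasDerivAt_slice_right {t x : ℝ} (hv : DifferentiableAt ℝ (Function.uncurry v) (t, x)) :
    HasDerivAt (fun y => v t y) (fderiv ℝ (Function.uncurry v) (t, x) (0, 1)) x :=
  hv.hasFDerivAt.comp_hasDerivAt (f := fun y => (t, y)) x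
    ((hasDerivAt_const x t).prodMk (hasDerivAt_id x))

theorem hasDerivAt_pdt (hv : Differentiable ℝ (Function.uncurry v)) (t x : ℝ) :
    HasDerivAt (fun s => v s x) (pdt v t x) t :=
  (hasDerivAt_slice_left (hv (t, x))).differentiableAt.hasDerivAt

theorem hasDerivAt_pdx (hv : Differentiable ℝ (Function.uncurry v)) (t x : ℝ) :
    HasDerivAt (fun y => v t y) (pdx v t x) x :=
  (hasDerivAt_slice_right (hv (t, x))).differentiableAt.hasDerivAt

theorem uncurry_pdt (hv : Differentiable ℝ (Function.uncurry v)) :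
    Function.uncurry (pdt v) = fun p => fderiv ℝ (Function.uncurry v) p (1, 0) :=
  funext fun p => (hasDerivAt_slice_left (hv p)).deriv

theorem uncurry_pdx (hv : Differentiable ℝ (Function.uncurry v)) :
    Function.uncurry (pdx v) = fun p => fderiv ℝ (Function.uncurry v) p (0, 1) :=
  funext fun p => (hasDerivAt_slice_right (hv p)).deriv

theorem contDiff_pdt {n : ℕ} (hv : ContDiff ℝ (n + 1) (Function.uncurry v)) :
    ContDiff ℝ n (Function.uncurry (pdt v)) := by
  rw [uncurry_pdt (hv.differentiable (by simp))]
  exact (hv.fderiv_right le_rfl).clm_apply contDiff_const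

theorem contDiff_pdx {n : ℕ} (hv : ContDiff ℝ (n + 1) (Function.uncurry v)) :
    ContDiff ℝ n (Function.uncurry (pdx v)) := by
  rw [uncurry_pdx (hv.differentiable (by simp))]
  exact (hv.fderiv_right le_rfl).clm_apply contDiff_const

theorem continuous_pdt (hv : ContDiff ℝ 1 (Function.uncurry v)) :
    Continuous (Function.uncurry (pdt v)) :=
  (contDiff_pdt (n := 0) (by simpa using hv)).continuous

theorem continuous_pdx (hv : ContDiff ℝ 1 (Function.uncurry v)) :
    Continuous (Function.uncurry (pdx v)) :=
  (contDiff_pdx (n := 0) (by simpa using hv)).continuous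

theorem pdt_pdx_comm (hv : ContDiff ℝ 2 (Function.uncurry v)) (t x : ℝ) :
    pdt (pdx v) t x = pdx (pdt v) t x := by
  have hd : Differentiable ℝ (Function.uncurry v) := hv.differentiable (by simp)
  have hf : Differentiable ℝ (fderiv ℝ (Function.uncurry v)) :=
    (hv.fderiv_right (m := 1) (by norm_num)).differentiable (by simp)
  have hx : pdt (pdx v) t x
      = fderiv ℝ (fderiv ℝ (Function.uncurry v)) (t, x) (1, 0) (0, 1) := by
    have h := hasDerivAt_slice_left (v := pdx v) (t := t) (x := x)
      (by rw [uncurry_pdx hd]; exact (hf _).clm_apply (differentiableAt_const _))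
    rw [pdt, h.deriv, uncurry_pdx hd, fderiv_clm_apply (hf _) (differentiableAt_const _)]
    simp
  have ht : pdx (pdt v) t x
      = fderiv ℝ (fderiv ℝ (Function.uncurry v)) (t, x) (0, 1) (1, 0) := by
    have h := hasDerivAt_slice_right (v := pdt v) (t := t) (x := x)
      (by rw [uncurry_pdt hd]; exact (hf _).clm_apply (differentiableAt_const _))
    rw [pdx, h.deriv, uncurry_pdt hd, fderiv_clm_apply (hf _) (differentiableAt_const _)]
    simp
  rw [hx, ht]
  exact (hv.contDiffAt.isSymmSndFDerivAt (by simp)).eq _ _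

theorem hasDerivAt_integral_pdt (hv : ContDiff ℝ 1 (Function.uncurry v)) (a b t : ℝ) :
    HasDerivAt (fun s => ∫ x in a..b, v s x) (∫ x in a..b, pdt v t x) t := by
  have hc := continuous_pdt hv
  obtain ⟨C, hC⟩ := ((isCompact_closedBall t 1).prod
    (isCompact_uIcc (a := a) (b := b))).exists_bound_of_continuousOn hc.continuousOn
  have hslice (s : ℝ) : Continuous (v s) := hv.continuous.comp (Continuous.prodMk_right s)
  refine (intervalIntegral.hasDerivAt_integral_of_dominated_loc_of_deriv_le
    (F := v) (F' := pdt v) (bound := fun _ => C)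
    (Metric.closedBall_mem_nhds t one_pos)
    (Filter.Eventually.of_forall fun s => (hslice s).aestronglyMeasurable)
    ((hslice t).intervalIntegrable _ _)
    (hc.comp (Continuous.prodMk_right t)).aestronglyMeasurable
    (Filter.Eventually.of_forall fun x hx s hs => hC (s, x) ⟨hs, uIoc_subset_uIcc hx⟩)
    intervalIntegrable_const
    (Filter.Eventually.of_forall fun x _ s _ =>
      hasDerivAt_pdt (hv.differentiable (by simp)) s x)).2

theorem hasDerivAt_integral_sq (hv : ContDiff ℝ 1 (Function.uncurry v)) (a b t : ℝ) :
    HasDerivAt (fun s => ∫ x in a..b, v s x ^ 2) (∫ x in a..b, 2 * (v t x * pdt v t x)) t := by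
  convert hasDerivAt_integral_pdt (v := fun s x => v s x ^ 2) (hv.pow 2) a b t using 3 with x
  have h := ((hasDerivAt_pdt (hv.differentiable (by simp)) t x).pow 2).deriv
  simp only [Pi.pow_def] at h
  rw [pdt, pdt, h, pdt]
  ring

end PartialDerivatives

theorem eqOn_zero_Icc_of_Ioo {g : ℝ → ℝ} (hg : Continuous g) {a b : ℝ} (hab : a < b)
    (h : ∀ t ∈ Ioo a b, g t = 0) : ∀ t ∈ Icc a b, g t = 0 := by
  have := Set.EqOn.closure (f := g) (g := fun _ => 0) h hg continuous_const
  rwa [closure_Ioo hab.ne] at this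

theorem eq_left_of_hasDerivAt_zero {f f' : ℝ → ℝ} {a b : ℝ}
    (hf : ∀ t ∈ Icc a b, HasDerivAt f (f' t) t) (h0 : ∀ t ∈ Icc a b, f' t = 0) :
    ∀ t ∈ Icc a b, f t = f a :=
  constant_of_has_deriv_right_zero (fun t ht => (hf t ht).continuousAt.continuousWithinAt)
    fun t ht => by
      have h := hf t (Ico_subset_Icc_self ht)
      rw [h0 t (Ico_subset_Icc_self ht)] at h
      exact h.hasDerivWithinAt

/-- A function that vanishes at `0` and `1` and has zero second derivative on `[0,1]` vanishes. -/
theorem eq_zero_of_second_deriv_zero {g g' g'' : ℝ → ℝ}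
    (hg : ∀ x ∈ Icc (0 : ℝ) 1, HasDerivAt g (g' x) x)
    (hg' : ∀ x ∈ Icc (0 : ℝ) 1, HasDerivAt g' (g'' x) x)
    (h2 : ∀ x ∈ Icc (0 : ℝ) 1, g'' x = 0) (h0 : g 0 = 0) (h1 : g 1 = 0) :
    ∀ x ∈ Icc (0 : ℝ) 1, g x = 0 := by
  have hk := eq_left_of_hasDerivAt_zero hg' h2
  have hlin := eq_left_of_hasDerivAt_zero (f := fun x => g x - g' 0 * x)
    (fun x hx => (hg x hx).sub ((hasDerivAt_id x).const_mul (g' 0)))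
    (fun x hx => by rw [hk x hx]; ring)
  have h := hlin 1 (by simp)
  simp only [h0, h1] at h
  intro x hx
  have := hlin x hx
  simp only [h0] at this
  have hz : g' 0 = 0 := by linarith
  rw [hz] at this
  linarith

theorem hasDerivAt_zero_of_eqOn_Ioo {f : ℝ → ℝ} {f' t a b : ℝ} (ht : t ∈ Ioo a b)
    (hf : HasDerivAt f f' t) (h : ∀ s ∈ Ioo a b, f s = 0) : f' = 0 := by
  refine hf.unique ((hasDerivAt_const t (0 : ℝ)).congr_of_eventuallyEq ?_)
  filter_upwards [isOpen_Ioo.mem_nhds ht] with s hs using h s hs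

/-- If `f ^ k * f'` vanishes on an interval then so does `f'`. -/
theorem deriv_eq_zero_of_pow_mul_deriv {f f' : ℝ → ℝ} {a b : ℝ} {k : ℕ}
    (hf : ∀ t ∈ Icc a b, HasDerivAt f (f' t) t) (h : ∀ t ∈ Icc a b, f t ^ k * f' t ^ 2 = 0) :
    ∀ t ∈ Ioo a b, f' t = 0 := by
  have hmul : ∀ t ∈ Icc a b, f t = 0 ∨ f' t = 0 := fun t ht =>
    (mul_eq_zero.1 (h t ht)).imp eq_zero_of_pow_eq_zero eq_zero_of_pow_eq_zero
  have hsq := eq_left_of_hasDerivAt_zero (fun t ht => (hf t ht).pow 2)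
    (fun t ht => by rcases hmul t ht with h | h <;> simp [h])
  simp only [Pi.pow_apply] at hsq
  intro t ht
  have htI := Ioo_subset_Icc_self ht
  rcases hmul t htI with h0 | h0
  · refine hasDerivAt_zero_of_eqOn_Ioo ht (hf t htI) fun s hs => ?_
    have := (hsq s (Ioo_subset_Icc_self hs)).trans (hsq t htI).symm
    rw [h0] at this
    exact eq_zero_of_pow_eq_zero (n := 2) (by simpa using this)
  · exact h0

section Energy

variable {α T : ℝ} {m : ℕ} {u : ℝ → ℝ → ℝ}

theorem hasDerivAt_energy (hu : ContDiff ℝ 2 (Function.uncurry u)) (t : ℝ) :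
    HasDerivAt (energy u)
      (∫ x in (0 : ℝ)..1, (pdx u t x * pdx (pdt u) t x + pdt u t x * pdt (pdt u) t x)) t := by
  have hx := contDiff_pdx (n := 1) (by norm_num; exact hu)
  have ht := contDiff_pdt (n := 1) (by norm_num; exact hu)
  refine (((hasDerivAt_integral_sq hx 0 1 t).const_mul (1 / 2)).add
    ((hasDerivAt_integral_sq ht 0 1 t).const_mul (1 / 2))).congr_deriv ?_
  have c1 : Continuous (pdx u t) := hx.continuous.comp (Continuous.prodMk_right t)
  have c2 : Continuous (pdt u t) := ht.continuous.comp (Continuous.prodMk_right t)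
  have c3 : Continuous (pdx (pdt u) t) :=
    (continuous_pdx ht).comp (Continuous.prodMk_right t)
  have c4 : Continuous (pdt (pdt u) t) :=
    (continuous_pdt ht).comp (Continuous.prodMk_right t)
  simp only [pdt_pdx_comm hu, intervalIntegral.integral_const_mul]
  rw [intervalIntegral.integral_add (Continuous.intervalIntegrable (by fun_prop) _ _)
    (Continuous.intervalIntegrable (by fun_prop) _ _)]
  ring

theorem pdt_boundary (hu : IsClassicalSolution α m T u) {t : ℝ} (ht : t ∈ Ioo 0 T) :
    pdt u t 0 = 0 ∧ pdt u t 1 = 0 := by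
  have hd := hu.1.differentiable (by simp)
  exact ⟨hasDerivAt_zero_of_eqOn_Ioo ht (hasDerivAt_pdt hd t 0)
      fun s hs => (hu.2.2 s (Ioo_subset_Icc_self hs)).1,
    hasDerivAt_zero_of_eqOn_Ioo ht (hasDerivAt_pdt hd t 1)
      fun s hs => (hu.2.2 s (Ioo_subset_Icc_self hs)).2⟩

/-- The energy identity. -/
theorem IsClassicalSolution.hasDerivAt_energy (hu : IsClassicalSolution α m T u) {t : ℝ}
    (ht : t ∈ Ioo 0 T) :
    HasDerivAt (energy u)
      (-α * ∫ x in (0 : ℝ)..1, u t x ^ (2 * m) * pdt u t x ^ 2) t := by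
  convert _root_.hasDerivAt_energy hu.1 t using 1
  have hx := contDiff_pdx (v := u) (n := 1) (by norm_num; exact hu.1)
  have ht' := contDiff_pdt (v := u) (n := 1) (by norm_num; exact hu.1)
  have c0 : Continuous (u t) := hu.1.continuous.comp (Continuous.prodMk_right t)
  have c1 : Continuous (pdx u t) := hx.continuous.comp (Continuous.prodMk_right t)
  have c2 : Continuous (pdt u t) := ht'.continuous.comp (Continuous.prodMk_right t)
  have c3 : Continuous (pdx (pdt u) t) :=
    (continuous_pdx ht').comp (Continuous.prodMk_right t)
  have c4 : Continuous (pdx (pdx u) t) :=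
    (continuous_pdx hx).comp (Continuous.prodMk_right t)
  have hflux : ∫ x in (0 : ℝ)..1, (pdx (pdx u) t x * pdt u t x + pdx u t x * pdx (pdt u) t x)
      = 0 := by
    rw [intervalIntegral.integral_deriv_mul_eq_sub
      (fun x _ => hasDerivAt_pdx (hx.differentiable (by simp)) t x)
      (fun x _ => hasDerivAt_pdx (ht'.differentiable (by simp)) t x)
      (c4.intervalIntegrable _ _) (c3.intervalIntegrable _ _)]
    simp [pdt_boundary hu ht]
  refine (zero_add _).symm.trans ((congrArg (· + _) hflux.symm).trans ?_)
  rw [← intervalIntegral.integral_const_mul, ← intervalIntegral.integral_add (Continuous.intervalIntegrable (by fun_prop) _ _)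
      (Continuous.intervalIntegrable (by fun_prop) _ _)]
  refine intervalIntegral.integral_congr fun x hx' => ?_
  rw [uIcc_of_le zero_le_one] at hx'
  have := hu.2.1 t (Ioo_subset_Icc_self ht) x hx'
  linear_combination (-pdt u t x) * this

theorem IsClassicalSolution.antitoneOn_energy (hα : 0 < α) (hu : IsClassicalSolution α m T u) :
    AntitoneOn (energy u) (Icc 0 T) := by
  refine antitoneOn_of_deriv_nonpos (convex_Icc _ _)
    (fun t _ => (_root_.hasDerivAt_energy hu.1 t).continuousAt.continuousWithinAt)
    (fun t _ => (_root_.hasDerivAt_energy hu.1 t).differentiableAt.differentiableWithinAt)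
    fun t ht => ?_
  rw [interior_Icc] at ht
  rw [(hu.hasDerivAt_energy ht).deriv, neg_mul, neg_nonpos]
  refine mul_nonneg hα.le (intervalIntegral.integral_nonneg zero_le_one fun x _ => ?_)
  have : 0 ≤ u t x ^ (2 * m) := (even_two_mul m).pow_nonneg _
  positivity

theorem IsClassicalSolution.damping_eq_zero (hα : 0 < α) (hu : IsClassicalSolution α m T u)
    {a b : ℝ} (ha : 0 ≤ a) (hab : a < b) (hb : b ≤ T) (hE : energy u a = energy u b) :
    ∀ t ∈ Icc a b, ∀ x ∈ Icc (0 : ℝ) 1, u t x ^ (2 * m) * pdt u t x ^ 2 = 0 := by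
  have hct := continuous_pdt (v := u) (hu.1.of_le (by norm_num))
  have hanti := hu.antitoneOn_energy hα
  have hsub : Icc a b ⊆ Icc 0 T := Icc_subset_Icc ha hb
  have hconst : ∀ s ∈ Ioo a b, energy u s - energy u a = 0 := fun s hs => by
    have hs' := Ioo_subset_Icc_self hs
    have h1 := hanti (hsub (left_mem_Icc.2 hab.le)) (hsub hs') hs'.1
    have h2 := hanti (hsub hs') (hsub (right_mem_Icc.2 hab.le)) hs'.2
    linarith
  intro t ht x hx
  refine eqOn_zero_Icc_of_Ioo (g := fun t => u t x ^ (2 * m) * pdt u t x ^ 2)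
    (((hu.1.continuous.comp (Continuous.prodMk_left x)).pow _).mul
      ((hct.comp (Continuous.prodMk_left x)).pow 2)) hab (fun t ht => ?_) t ht
  have hzero := hasDerivAt_zero_of_eqOn_Ioo ht
    ((hu.hasDerivAt_energy (Ioo_subset_Ioo ha hb ht)).sub_const (energy u a)) hconst
  have hnn : ∀ y, 0 ≤ u t y ^ (2 * m) * pdt u t y ^ 2 := fun y =>
    mul_nonneg ((even_two_mul m).pow_nonneg _) (sq_nonneg _)
  by_contra hne
  have hpos := intervalIntegral.integral_pos zero_lt_one
    (f := fun y => u t y ^ (2 * m) * pdt u t y ^ 2)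
    (((hu.1.continuous.comp (Continuous.prodMk_right t)).pow _).mul
      ((hct.comp (Continuous.prodMk_right t)).pow 2)).continuousOn
    (fun y _ => hnn y) ⟨x, hx, (hnn x).lt_of_ne' hne⟩
  have := mul_pos hα hpos
  linarith

theorem IsClassicalSolution.eq_zero_of_energy_eq (hα : 0 < α) (hu : IsClassicalSolution α m T u)
    {a b : ℝ} (ha : 0 ≤ a) (hab : a < b) (hb : b ≤ T) (hE : energy u a = energy u b) :
    ∀ t ∈ Icc a b, ∀ x ∈ Icc (0 : ℝ) 1, u t x = 0 := by
  have hd := hu.1.differentiable (by simp)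
  have hx := (contDiff_pdx (v := u) (n := 1) (by norm_num; exact hu.1)).differentiable (by simp)
  have ht' := (contDiff_pdt (v := u) (n := 1) (by norm_num; exact hu.1)).differentiable (by simp)
  have hut : ∀ x ∈ Icc (0 : ℝ) 1, ∀ t ∈ Ioo a b, pdt u t x = 0 := fun x hx =>
    deriv_eq_zero_of_pow_mul_deriv (fun t _ => hasDerivAt_pdt hd t x)
      fun t ht => hu.damping_eq_zero hα ha hab hb hE t ht x hx
  intro t ht x hxI
  refine eqOn_zero_Icc_of_Ioo (g := fun t => u t x)
    (hu.1.continuous.comp (Continuous.prodMk_left x)) hab (fun t ht => ?_) t ht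
  have htT : t ∈ Icc 0 T := Icc_subset_Icc ha hb (Ioo_subset_Icc_self ht)
  refine eq_zero_of_second_deriv_zero (fun y _ => hasDerivAt_pdx hd t y)
    (fun y _ => hasDerivAt_pdx hx t y) (fun y hy => ?_) (hu.2.2 t htT).1 (hu.2.2 t htT).2 x hxI
  have hutt : pdt (pdt u) t y = 0 :=
    hasDerivAt_zero_of_eqOn_Ioo ht (hasDerivAt_pdt ht' t y) (hut y hy)
  have hpde := hu.2.1 t htT y hy
  rw [hutt, hut y hy t ht] at hpde
  linarith

theorem IsClassicalSolution.energy_eq_zero (hu : IsClassicalSolution α m T u) {a b : ℝ}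
    (hab : a < b) (h0 : ∀ t ∈ Icc a b, ∀ x ∈ Icc (0 : ℝ) 1, u t x = 0) :
    ∀ t ∈ Icc a b, energy u t = 0 := by
  have hd := hu.1.differentiable (by simp)
  have hu1 : ContDiff ℝ 1 (Function.uncurry u) := hu.1.of_le (by norm_num)
  intro t ht
  have hux : ∀ x ∈ uIcc (0 : ℝ) 1, pdx u t x ^ 2 = 0 := by
    rw [uIcc_of_le zero_le_one]
    intro x hx
    rw [eqOn_zero_Icc_of_Ioo (g := pdx u t)
      ((continuous_pdx hu1).comp (Continuous.prodMk_right t)) zero_lt_one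
      (fun y hy => hasDerivAt_zero_of_eqOn_Ioo hy (hasDerivAt_pdx hd t y)
        fun z hz => h0 t ht z (Ioo_subset_Icc_self hz)) x hx]
    norm_num
  have hut : ∀ x ∈ uIcc (0 : ℝ) 1, pdt u t x ^ 2 = 0 := by
    rw [uIcc_of_le zero_le_one]
    intro x hx
    rw [eqOn_zero_Icc_of_Ioo (g := fun t => pdt u t x)
      ((continuous_pdt hu1).comp (Continuous.prodMk_left x)) hab
      (fun s hs => hasDerivAt_zero_of_eqOn_Ioo hs (hasDerivAt_pdt hd s x)
        fun r hr => h0 r (Ioo_subset_Icc_self hr) x hx) t ht]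
    norm_num
  rw [energy, intervalIntegral.integral_congr hux, intervalIntegral.integral_congr hut]
  simp

end Energy

/-- Strict decay of the energy (rigidity): if the energy is equal at two times then the
solution vanishes in between, and the energy is strictly decreasing wherever positive. -/
theorem strict_energy_decay
    (α : ℝ) (hα : 0 < α) (m : ℕ) (hm : 1 ≤ m) (T : ℝ) (hT : 0 ≤ T)
    (u : ℝ → ℝ → ℝ) (hu : IsClassicalSolution α m T u) :
    (∀ a b : ℝ, 0 ≤ a → a < b → b ≤ T → energy u a = energy u b →
      (∀ t ∈ Icc a b, ∀ x ∈ Icc (0:ℝ) 1, u t x = 0) ∧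
      (∀ t ∈ Icc a b, energy u t = 0)) ∧
    (∀ a b : ℝ, 0 ≤ a → a < b → b ≤ T → (∀ t ∈ Icc a b, 0 < energy u t) →
      StrictAntiOn (energy u) (Icc a b)) := by
  have rigid : ∀ a b : ℝ, 0 ≤ a → a < b → b ≤ T → energy u a = energy u b →
      (∀ t ∈ Icc a b, ∀ x ∈ Icc (0:ℝ) 1, u t x = 0) ∧
      (∀ t ∈ Icc a b, energy u t = 0) := fun a b ha hab hb hE =>
    have h0 := hu.eq_zero_of_energy_eq hα ha hab hb hE
    ⟨h0, hu.energy_eq_zero hab h0⟩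
  refine ⟨rigid, fun a b ha _ hb hpos s hs t ht hst => ?_⟩
  have hsub : Icc a b ⊆ Icc 0 T := Icc_subset_Icc ha hb
  refine (hu.antitoneOn_energy hα (hsub hs) (hsub ht) hst.le).lt_of_ne fun heq => ?_
  exact (hpos s hs).ne' ((rigid s t (hsub hs).1 hst (hsub ht).2 heq.symm).2 s
    (left_mem_Icc.2 hst.le))
end

section
/- Comparison with the conservative problem: fix ε ∈ (0, 1/2). There exists a constant C > 0, depending only on α, m and ε, with the following property: for every integer k ≥ 1, every T > 0, and every classical solution u of the degenerately damped wave equation on [0,T] with initial data u(0,x) = (2/(kπ)) sin(kπx), ∂ₜu(0,x) = 0, the difference z := u − w, where w(t,x) = (2/(kπ)) cos(kπt) sin(kπx) is the solution of the undamped linear wave equation with the same data, satisfies E_z(t) ≤ C T k^(−ε) for all t ∈ [0,T]. -/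
open MeasureTheory Real Set

/-- `v` is twice continuously differentiable, with first partial derivatives `vt`, `vx` and
second partial derivatives `vtt`, `vtx`, `vxx`. -/
structure HasPartialDerivs (v vt vx vtt vtx vxx : ℝ → ℝ → ℝ) : Prop where
  continuous : Continuous (Function.uncurry v)
  continuous_t : Continuous (Function.uncurry vt)
  continuous_x : Continuous (Function.uncurry vx)
  continuous_tt : Continuous (Function.uncurry vtt)
  continuous_tx : Continuous (Function.uncurry vtx)
  continuous_xx : Continuous (Function.uncurry vxx)
  deriv_t : ∀ t x, HasDerivAt (fun s => v s x) (vt t x) t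
  deriv_x : ∀ t x, HasDerivAt (fun y => v t y) (vx t x) x
  deriv_tt : ∀ t x, HasDerivAt (fun s => vt s x) (vtt t x) t
  deriv_tx : ∀ t x, HasDerivAt (fun y => vt t y) (vtx t x) x
  deriv_xt : ∀ t x, HasDerivAt (fun s => vx s x) (vtx t x) t
  deriv_xx : ∀ t x, HasDerivAt (fun y => vx t y) (vxx t x) x

/-- Differentiation under the integral sign, for a continuous partial derivative. -/
lemma hasDerivAt_intervalIntegral_of_continuous {f f' : ℝ → ℝ → ℝ} {a b : ℝ}
    (hf : Continuous (Function.uncurry f)) (hf' : Continuous (Function.uncurry f'))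
    (hd : ∀ p y, HasDerivAt (fun q => f q y) (f' p y) p) (p : ℝ) :
    HasDerivAt (fun q => ∫ y in a..b, f q y) (∫ y in a..b, f' p y) p := by
  obtain ⟨M, hM⟩ := ((isCompact_Icc (a := p - 1) (b := p + 1)).prod
    (isCompact_uIcc (a := a) (b := b))).exists_bound_of_continuousOn hf'.continuousOn
  refine (intervalIntegral.hasDerivAt_integral_of_dominated_loc_of_deriv_le
    (μ := volume) (bound := fun _ => M)
    (Icc_mem_nhds (sub_one_lt p) (lt_add_one p)) (Filter.Eventually.of_forall fun q => ?_)
    ((hf.uncurry_left p).intervalIntegrable a b) ?_ ?_ (by simp) ?_).2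
  · exact (hf.uncurry_left q).aestronglyMeasurable
  · exact (hf'.uncurry_left p).aestronglyMeasurable
  · exact Filter.Eventually.of_forall fun y hy q hq => hM (q, y) ⟨hq, uIoc_subset_uIcc hy⟩
  · exact Filter.Eventually.of_forall fun y _ q _ => hd q y

/-- A differentiable function constant on an interval has zero derivative there, endpoints
included. -/
lemma hasDerivAt_eq_zero_of_eqOn_Icc {f : ℝ → ℝ} {f' a b c x : ℝ} (hab : a < b)
    (hf : ∀ y ∈ Icc a b, f y = c) (hx : x ∈ Icc a b) (hd : HasDerivAt f f' x) : f' = 0 :=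
  (uniqueDiffOn_Icc hab x hx).eq_deriv _ hd.hasDerivWithinAt
    ((hasDerivWithinAt_const x (Icc a b) c).congr hf (hf x hx))

namespace HasPartialDerivs

variable {v vt vx vtt vtx vxx w wt wx wtt wtx wxx : ℝ → ℝ → ℝ}

lemma pdt_eq (h : HasPartialDerivs v vt vx vtt vtx vxx) : pdt v = vt := by
  ext t x; exact (h.deriv_t t x).deriv

lemma pdx_eq (h : HasPartialDerivs v vt vx vtt vtx vxx) : pdx v = vx := by
  ext t x; exact (h.deriv_x t x).deriv

lemma sub (h : HasPartialDerivs v vt vx vtt vtx vxx) (h' : HasPartialDerivs w wt wx wtt wtx wxx) :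
    HasPartialDerivs (fun t x => v t x - w t x) (fun t x => vt t x - wt t x)
      (fun t x => vx t x - wx t x) (fun t x => vtt t x - wtt t x)
      (fun t x => vtx t x - wtx t x) (fun t x => vxx t x - wxx t x) where
  continuous := h.continuous.sub h'.continuous
  continuous_t := h.continuous_t.sub h'.continuous_t
  continuous_x := h.continuous_x.sub h'.continuous_x
  continuous_tt := h.continuous_tt.sub h'.continuous_tt
  continuous_tx := h.continuous_tx.sub h'.continuous_tx
  continuous_xx := h.continuous_xx.sub h'.continuous_xx
  deriv_t t x := (h.deriv_t t x).sub (h'.deriv_t t x)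
  deriv_x t x := (h.deriv_x t x).sub (h'.deriv_x t x)
  deriv_tt t x := (h.deriv_tt t x).sub (h'.deriv_tt t x)
  deriv_tx t x := (h.deriv_tx t x).sub (h'.deriv_tx t x)
  deriv_xt t x := (h.deriv_xt t x).sub (h'.deriv_xt t x)
  deriv_xx t x := (h.deriv_xx t x).sub (h'.deriv_xx t x)

/-- The primitive in time of a `C²` function. -/
lemma primitive (h : HasPartialDerivs v vt vx vtt vtx vxx) :
    HasPartialDerivs (fun t x => ∫ s in (0:ℝ)..t, v s x) v (fun t x => ∫ s in (0:ℝ)..t, vx s x)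
      vt vx (fun t x => ∫ s in (0:ℝ)..t, vxx s x) := by
  have cont {f : ℝ → ℝ → ℝ} (hf : Continuous (Function.uncurry f)) :
      Continuous (Function.uncurry fun t x => ∫ s in (0:ℝ)..t, f s x) :=
    intervalIntegral.continuous_parametric_intervalIntegral_of_continuous
      (f := fun (p : ℝ × ℝ) s => f s p.2) (s := fun p => p.1)
      (hf.comp (continuous_snd.prodMk (continuous_snd.comp continuous_fst))) continuous_fst
  have dt {f : ℝ → ℝ → ℝ} (hf : Continuous (Function.uncurry f)) (t x : ℝ) :
      HasDerivAt (fun τ => ∫ s in (0:ℝ)..τ, f s x) (f t x) t :=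
    (hf.uncurry_right x).integral_hasStrictDerivAt 0 t |>.hasDerivAt
  have dx {f f' : ℝ → ℝ → ℝ} (hf : Continuous (Function.uncurry f))
      (hf' : Continuous (Function.uncurry f'))
      (hd : ∀ s x, HasDerivAt (fun y => f s y) (f' s x) x) (t x : ℝ) :
      HasDerivAt (fun y => ∫ s in (0:ℝ)..t, f s y) (∫ s in (0:ℝ)..t, f' s x) x :=
    hasDerivAt_intervalIntegral_of_continuous (f := fun y s => f s y) (f' := fun y s => f' s y)
      (hf.comp continuous_swap) (hf'.comp continuous_swap) (fun y s => hd s y) x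
  exact
  { continuous := cont h.continuous
    continuous_t := h.continuous
    continuous_x := cont h.continuous_x
    continuous_tt := h.continuous_t
    continuous_tx := h.continuous_x
    continuous_xx := cont h.continuous_xx
    deriv_t := dt h.continuous
    deriv_x := dx h.continuous h.continuous_x h.deriv_x
    deriv_tt := h.deriv_t
    deriv_tx := h.deriv_x
    deriv_xt := dt h.continuous_x
    deriv_xx := dx h.continuous_x h.continuous_xx h.deriv_xx }

lemma energy_eq (h : HasPartialDerivs v vt vx vtt vtx vxx) (t : ℝ) :
    energy v t = (1/2) * (∫ x in (0:ℝ)..1, (vx t x)^2) + (1/2) * (∫ x in (0:ℝ)..1, (vt t x)^2) := by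
  rw [energy, h.pdt_eq, h.pdx_eq]

/-- The energy identity `E' = ∫ vₜ (vₜₜ - vₓₓ)` under Dirichlet boundary conditions. -/
lemma hasDerivAt_energy (h : HasPartialDerivs v vt vx vtt vtx vxx) {t : ℝ}
    (h0 : vt t 0 = 0) (h1 : vt t 1 = 0) :
    HasDerivAt (energy v) (∫ x in (0:ℝ)..1, vt t x * (vtt t x - vxx t x)) t := by
  have cx := h.continuous_x
  have ct := h.continuous_t
  have ctx := h.continuous_tx
  have ctt := h.continuous_tt
  have cxx := h.continuous_xx
  have dX := hasDerivAt_intervalIntegral_of_continuous (a := 0) (b := 1)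
    (f := fun t x => (vx t x)^2) (f' := fun t x => 2 * vx t x * vtx t x)
    ((continuous_pow 2).comp cx) ((continuous_const.fun_mul cx).fun_mul ctx)
    (fun p y => by simpa using (h.deriv_xt p y).fun_pow 2) t
  have dT := hasDerivAt_intervalIntegral_of_continuous (a := 0) (b := 1)
    (f := fun t x => (vt t x)^2) (f' := fun t x => 2 * vt t x * vtt t x)
    ((continuous_pow 2).comp ct) ((continuous_const.fun_mul ct).fun_mul ctt)
    (fun p y => by simpa using (h.deriv_tt p y).fun_pow 2) t
  replace cx := cx.uncurry_left t
  replace ct := ct.uncurry_left t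
  replace ctx := ctx.uncurry_left t
  replace ctt := ctt.uncurry_left t
  replace cxx := cxx.uncurry_left t
  have parts : ∫ x in (0:ℝ)..1, (vxx t x * vt t x + vx t x * vtx t x) = 0 := by
    rw [intervalIntegral.integral_eq_sub_of_hasDerivAt
      (fun x _ => (h.deriv_xx t x).mul (h.deriv_tx t x))
      (Continuous.intervalIntegrable (by fun_prop) _ _)]
    simp [h0, h1]
  have key := (dX.const_mul (1/2)).add (dT.const_mul (1/2))
  have e : energy v = (fun t => (1/2) * ∫ x in (0:ℝ)..1, (vx t x)^2) +
      fun t => (1/2) * ∫ x in (0:ℝ)..1, (vt t x)^2 := funext h.energy_eq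
  rw [e]
  refine key.congr_deriv (Eq.trans ?_ (add_eq_left.2 parts))
  rw [← intervalIntegral.integral_const_mul, ← intervalIntegral.integral_const_mul,
    ← intervalIntegral.integral_add, ← intervalIntegral.integral_add]
  · congr 1; ext x; ring
  all_goals exact Continuous.intervalIntegrable (by fun_prop) _ _

/-- A bound on the energy production integrates to a bound on the energy. -/
lemma energy_sub_le (h : HasPartialDerivs v vt vx vtt vtx vxx) {T : ℝ} {G g : ℝ → ℝ}
    (hbd : ∀ t ∈ Icc 0 T, vt t 0 = 0 ∧ vt t 1 = 0)
    (hG : ∀ t, HasDerivAt G (g t) t)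
    (hg : ∀ t ∈ Icc 0 T, ∫ x in (0:ℝ)..1, vt t x * (vtt t x - vxx t x) ≤ g t)
    {t : ℝ} (ht : t ∈ Icc 0 T) :
    energy v t - energy v 0 ≤ G t - G 0 := by
  have hd (s : ℝ) (hs : s ∈ Icc 0 T) :=
    (h.hasDerivAt_energy (hbd s hs).1 (hbd s hs).2).sub (hG s)
  have anti := antitoneOn_of_deriv_nonpos (convex_Icc 0 T)
    (fun s hs => (hd s hs).continuousAt.continuousWithinAt)
    (fun s hs => (hd s (interior_subset hs)).differentiableAt.differentiableWithinAt)
    (fun s hs => by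
      rw [(hd s (interior_subset hs)).deriv]
      linarith [hg s (interior_subset hs)])
  have := anti ⟨le_rfl, ht.1.trans ht.2⟩ ht ht.1
  simp only [Pi.sub_apply] at this
  linarith

/-- The energy controls the supremum of a function vanishing at `x = 0`. -/
lemma mul_abs_le_energy (h : HasPartialDerivs v vt vx vtt vtx vxx) {t x : ℝ}
    (h0 : v t 0 = 0) (hx : x ∈ Icc (0:ℝ) 1) {a : ℝ} (ha : 0 ≤ a) :
    a * |v t x| ≤ a ^ 2 + energy v t / 2 := by
  have cx := h.continuous_x.uncurry_left t
  have ct := h.continuous_t.uncurry_left t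
  have ftc : ∫ y in (0:ℝ)..x, vx t y = v t x := by
    rw [intervalIntegral.integral_eq_sub_of_hasDerivAt (fun y _ => h.deriv_x t y)
      (cx.intervalIntegrable _ _), h0, sub_zero]
  have hvt : 0 ≤ ∫ y in (0:ℝ)..1, (vt t y)^2 :=
    intervalIntegral.integral_nonneg zero_le_one fun y _ => sq_nonneg _
  rw [h.energy_eq, ← ftc]
  calc a * |∫ y in (0:ℝ)..x, vx t y|
      ≤ a * ∫ y in (0:ℝ)..x, |vx t y| := by
        gcongr; exact intervalIntegral.abs_integral_le_integral_abs hx.1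
    _ ≤ a * ∫ y in (0:ℝ)..1, |vx t y| := by
        gcongr
        exact intervalIntegral.integral_mono_interval le_rfl hx.1 hx.2
          (Filter.Eventually.of_forall fun y => abs_nonneg _)
          (cx.abs.intervalIntegrable _ _)
    _ = ∫ y in (0:ℝ)..1, a * |vx t y| := (intervalIntegral.integral_const_mul _ _).symm
    _ ≤ ∫ y in (0:ℝ)..1, (a ^ 2 + (1/4) * (vx t y)^2) := by
        refine intervalIntegral.integral_mono_on zero_le_one
          (Continuous.intervalIntegrable (by fun_prop) _ _)
          (Continuous.intervalIntegrable (by fun_prop) _ _) fun y _ => ?_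
        nlinarith [sq_nonneg (a - |vx t y| / 2), sq_abs (vx t y)]
    _ = a ^ 2 + (1/4) * ∫ y in (0:ℝ)..1, (vx t y)^2 := by
        rw [intervalIntegral.integral_add (by simp)
          (Continuous.intervalIntegrable (by fun_prop) _ _),
          intervalIntegral.integral_const_mul]
        simp
    _ ≤ _ := by linarith

end HasPartialDerivs

lemma ContDiff.hasPartialDerivs {u : ℝ → ℝ → ℝ} (hu : ContDiff ℝ 2 (Function.uncurry u)) :
    HasPartialDerivs u (pdt u) (pdx u) (pdt (pdt u)) (pdx (pdt u)) (pdx (pdx u)) := by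
  have dt {f : ℝ → ℝ → ℝ} (hf : ContDiff ℝ 1 (Function.uncurry f)) (t x : ℝ) :
      HasDerivAt (fun s => f s x) (fderiv ℝ (Function.uncurry f) (t, x) (1, 0)) t :=
    (hf.differentiable one_ne_zero (t, x)).hasFDerivAt.comp_hasDerivAt
      (f := fun s : ℝ => (s, x)) t ((hasDerivAt_id t).prodMk (hasDerivAt_const t x))
  have dx {f : ℝ → ℝ → ℝ} (hf : ContDiff ℝ 1 (Function.uncurry f)) (t x : ℝ) :
      HasDerivAt (fun y => f t y) (fderiv ℝ (Function.uncurry f) (t, x) (0, 1)) x :=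
    (hf.differentiable one_ne_zero (t, x)).hasFDerivAt.comp_hasDerivAt
      (f := fun y : ℝ => (t, y)) x ((hasDerivAt_const x t).prodMk (hasDerivAt_id x))
  have et {f : ℝ → ℝ → ℝ} (hf : ContDiff ℝ 1 (Function.uncurry f)) :
      Function.uncurry (pdt f) = fun p => fderiv ℝ (Function.uncurry f) p (1, 0) :=
    funext fun p => (dt hf p.1 p.2).deriv
  have ex {f : ℝ → ℝ → ℝ} (hf : ContDiff ℝ 1 (Function.uncurry f)) :
      Function.uncurry (pdx f) = fun p => fderiv ℝ (Function.uncurry f) p (0, 1) :=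
    funext fun p => (dx hf p.1 p.2).deriv
  have ct {f : ℝ → ℝ → ℝ} (hf : ContDiff ℝ 1 (Function.uncurry f)) :
      Continuous (Function.uncurry (pdt f)) := by
    rw [et hf]; exact (hf.continuous_fderiv one_ne_zero).clm_apply continuous_const
  have cx {f : ℝ → ℝ → ℝ} (hf : ContDiff ℝ 1 (Function.uncurry f)) :
      Continuous (Function.uncurry (pdx f)) := by
    rw [ex hf]; exact (hf.continuous_fderiv one_ne_zero).clm_apply continuous_const
  have h1 : ContDiff ℝ 1 (Function.uncurry u) := hu.of_le one_le_two
  have hfd : ContDiff ℝ 1 (fderiv ℝ (Function.uncurry u)) :=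
    hu.fderiv_right (by norm_num [one_add_one_eq_two])
  have ht : ContDiff ℝ 1 (Function.uncurry (pdt u)) := by
    rw [et h1]; exact hfd.clm_apply contDiff_const
  have hx : ContDiff ℝ 1 (Function.uncurry (pdx u)) := by
    rw [ex h1]; exact hfd.clm_apply contDiff_const
  have dt' {f : ℝ → ℝ → ℝ} (hf : ContDiff ℝ 1 (Function.uncurry f)) (t x : ℝ) :
      HasDerivAt (fun s => f s x) (pdt f t x) t := (dt hf t x).differentiableAt.hasDerivAt
  have dx' {f : ℝ → ℝ → ℝ} (hf : ContDiff ℝ 1 (Function.uncurry f)) (t x : ℝ) :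
      HasDerivAt (fun y => f t y) (pdx f t x) x := (dx hf t x).differentiableAt.hasDerivAt
  have symm (t x : ℝ) : pdt (pdx u) t x = pdx (pdt u) t x := by
    have hs : IsSymmSndFDerivAt ℝ (Function.uncurry u) (t, x) :=
      hu.contDiffAt.isSymmSndFDerivAt (by simp)
    have hdiff := hfd.differentiable one_ne_zero (t, x)
    have e1 : pdt (pdx u) t x = _ := (dt hx t x).deriv
    have e2 : pdx (pdt u) t x = _ := (dx ht t x).deriv
    rw [e1, e2, ex h1, et h1, fderiv_clm_apply hdiff (differentiableAt_const _),
      fderiv_clm_apply hdiff (differentiableAt_const _)]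
    simpa using hs.eq (1, 0) (0, 1)
  exact
  { continuous := hu.continuous
    continuous_t := ct h1
    continuous_x := cx h1
    continuous_tt := ct ht
    continuous_tx := cx ht
    continuous_xx := cx hx
    deriv_t := dt' h1
    deriv_x := dx' h1
    deriv_tt := dt' ht
    deriv_tx := dx' ht
    deriv_xt := fun t x => symm t x ▸ dt' hx t x
    deriv_xx := dx' hx }

lemma hasPartialDerivs_standingWave {κ : ℝ} (hκ : κ ≠ 0) :
    HasPartialDerivs (fun t x => (2 / κ) * Real.cos (κ * t) * Real.sin (κ * x))
      (fun t x => -2 * Real.sin (κ * t) * Real.sin (κ * x))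
      (fun t x => 2 * Real.cos (κ * t) * Real.cos (κ * x))
      (fun t x => -2 * κ * Real.cos (κ * t) * Real.sin (κ * x))
      (fun t x => -2 * κ * Real.sin (κ * t) * Real.cos (κ * x))
      (fun t x => -2 * κ * Real.cos (κ * t) * Real.sin (κ * x)) := by
  have ds (t : ℝ) : HasDerivAt (fun s => Real.sin (κ * s)) (κ * Real.cos (κ * t)) t := by
    simpa [mul_comm] using ((hasDerivAt_id t).const_mul κ).sin
  have dc (t : ℝ) : HasDerivAt (fun s => Real.cos (κ * s)) (-(κ * Real.sin (κ * t))) t := by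
    simpa [mul_comm] using ((hasDerivAt_id t).const_mul κ).cos
  constructor
  iterate 6 · simp only [Function.uncurry_def]; fun_prop
  · exact fun t x => (((dc t).const_mul _).mul_const _).congr_deriv (by field_simp)
  · exact fun t x => ((ds x).const_mul _).congr_deriv (by field_simp)
  · exact fun t x => (((ds t).const_mul _).mul_const _).congr_deriv (by ring)
  · exact fun t x => ((ds x).const_mul _).congr_deriv (by ring)
  · exact fun t x => (((dc t).const_mul _).mul_const _).congr_deriv (by ring)
  · exact fun t x => ((dc x).const_mul _).congr_deriv (by ring)

namespace IsClassicalSolution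

variable {α : ℝ} {m : ℕ} {T : ℝ} {u : ℝ → ℝ → ℝ}

lemma hasPartialDerivs (hu : IsClassicalSolution α m T u) :
    HasPartialDerivs u (pdt u) (pdx u) (pdt (pdt u)) (pdx (pdt u)) (pdx (pdx u)) :=
  hu.1.hasPartialDerivs

lemma sub_eq (hu : IsClassicalSolution α m T u) {t x : ℝ} (ht : t ∈ Icc 0 T)
    (hx : x ∈ Icc (0:ℝ) 1) :
    pdt (pdt u) t x - pdx (pdx u) t x = -(α * (u t x) ^ (2*m) * pdt u t x) := by
  linarith [hu.2.1 t ht x hx]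

lemma pdt_boundary (hu : IsClassicalSolution α m T u) (hT : 0 < T) {t : ℝ} (ht : t ∈ Icc 0 T) :
    pdt u t 0 = 0 ∧ pdt u t 1 = 0 :=
  ⟨hasDerivAt_eq_zero_of_eqOn_Icc hT (fun s hs => (hu.2.2 s hs).1) ht
      (hu.hasPartialDerivs.deriv_t t 0),
    hasDerivAt_eq_zero_of_eqOn_Icc hT (fun s hs => (hu.2.2 s hs).2) ht
      (hu.hasPartialDerivs.deriv_t t 1)⟩

/-- The energy does not exceed its initial value. -/
lemma energy_le (hu : IsClassicalSolution α m T u) (hα : 0 ≤ α) (hT : 0 < T) {t : ℝ}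
    (ht : t ∈ Icc 0 T) : energy u t ≤ energy u 0 := by
  have h := hu.hasPartialDerivs.energy_sub_le (G := fun _ => 0) (g := fun _ => 0)
    (fun s hs => hu.pdt_boundary hT hs) (fun s => hasDerivAt_const s 0) (fun s hs => ?_) ht
  · linarith
  · rw [← neg_nonneg, ← intervalIntegral.integral_neg]
    refine intervalIntegral.integral_nonneg zero_le_one fun x hx => ?_
    rw [hu.sub_eq hs hx]
    have : 0 ≤ α * (u s x) ^ (2*m) * (pdt u s x) ^ 2 := by
      rw [pow_mul]; positivity
    linarith

/-- Integrating the equation in time: the primitive `U = ∫₀ᵗ u` solves a wave equation with a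
monotone damping term `u^(2m+1)` and a forcing depending only on the initial datum. -/
lemma primitive_sub_eq (hu : IsClassicalSolution α m T u)
    (hv : ∀ x ∈ Icc (0:ℝ) 1, pdt u 0 x = 0) {t x : ℝ} (ht : t ∈ Icc 0 T)
    (hx : x ∈ Icc (0:ℝ) 1) :
    pdt u t x - ∫ s in (0:ℝ)..t, pdx (pdx u) s x =
      α / (2*m+1) * (u 0 x) ^ (2*m+1) - α / (2*m+1) * (u t x) ^ (2*m+1) := by
  have h := hu.hasPartialDerivs
  have hm : (2*m+1 : ℝ) ≠ 0 := by positivity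
  have hd (s : ℝ) : HasDerivAt (fun s => pdt u s x + α / (2*m+1) * (u s x) ^ (2*m+1))
      (pdt (pdt u) s x + α * (u s x) ^ (2*m) * pdt u s x) s :=
    ((h.deriv_tt s x).fun_add (((h.deriv_t s x).fun_pow (2*m+1)).const_mul _)).congr_deriv (by
      push_cast
      field_simp)
  have c := h.continuous.uncurry_right x
  have ct := h.continuous_t.uncurry_right x
  have ctt := h.continuous_tt.uncurry_right x
  have e : ∫ s in (0:ℝ)..t, pdx (pdx u) s x =
      ∫ s in (0:ℝ)..t, (pdt (pdt u) s x + α * (u s x) ^ (2*m) * pdt u s x) := by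
    refine intervalIntegral.integral_congr fun s hs => ?_
    rw [uIcc_of_le ht.1] at hs
    linarith [hu.sub_eq ⟨hs.1, hs.2.trans ht.2⟩ hx]
  rw [e, intervalIntegral.integral_eq_sub_of_hasDerivAt (fun s _ => hd s)
    (Continuous.intervalIntegrable (by fun_prop) _ _), hv x hx]
  ring

/-- The `L²` norm stays comparable, uniformly in time, to the sup norm of the initial datum. -/
lemma integral_sq_le (hu : IsClassicalSolution α m T u) (hα : 0 ≤ α) {a : ℝ}
    (ha : 0 ≤ a) (ha1 : a ≤ 1) (h0 : ∀ x ∈ Icc (0:ℝ) 1, |u 0 x| ≤ a)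
    (hv : ∀ x ∈ Icc (0:ℝ) 1, pdt u 0 x = 0) {t : ℝ} (ht : t ∈ Icc 0 T) :
    ∫ x in (0:ℝ)..1, (u t x) ^ 2 ≤ (2 + 4 * α ^ 2) * a ^ 2 := by
  have h := hu.hasPartialDerivs
  set U : ℝ → ℝ → ℝ := fun t x => ∫ s in (0:ℝ)..t, u s x with hU
  have hP := h.primitive
  set f : ℝ → ℝ := fun x => α / (2*m+1) * (u 0 x) ^ (2*m+1) with hf
  have cu0 := h.continuous.uncurry_left 0
  have cf : Continuous f := by fun_prop
  have cf' : Continuous fun p : ℝ × ℝ => f p.2 := cf.comp continuous_snd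
  have hβ : 0 ≤ α / (2*m+1) := by positivity
  have hβα : α / (2*m+1) ≤ α := div_le_self hα (by linarith [(Nat.cast_nonneg m : (0:ℝ) ≤ m)])
  have hfa (x : ℝ) (hx : x ∈ Icc (0:ℝ) 1) : |f x| ≤ α * a := by
    rw [hf, abs_mul, abs_of_nonneg hβ, abs_pow]
    gcongr
    calc |u 0 x| ^ (2*m+1) ≤ a ^ (2*m+1) := by gcongr; exact h0 x hx
      _ ≤ a := pow_le_of_le_one ha ha1 (by omega)
  have key := hP.energy_sub_le (T := T) (G := fun t => ∫ x in (0:ℝ)..1, f x * U t x)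
    (g := fun t => ∫ x in (0:ℝ)..1, f x * u t x) (fun s hs => hu.2.2 s hs)
    (hasDerivAt_intervalIntegral_of_continuous (cf'.mul hP.continuous) (cf'.mul h.continuous)
      (fun s x => (hP.deriv_t s x).const_mul (f x))) (fun s hs => ?_) ht
  · have E0 : energy U 0 ≤ a ^ 2 / 2 := by
      rw [hP.energy_eq]
      have : ∫ x in (0:ℝ)..1, (u 0 x) ^ 2 ≤ ∫ x in (0:ℝ)..1, a ^ 2 := by
        refine intervalIntegral.integral_mono_on zero_le_one
          ((cu0.pow 2).intervalIntegrable _ _) (by simp) fun x hx => ?_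
        exact sq_le_sq' (by linarith [abs_le.1 (h0 x hx)]) (abs_le.1 (h0 x hx)).2
      simp at this ⊢
      linarith
    have cU := hP.continuous.uncurry_left t
    have Gt : ∫ x in (0:ℝ)..1, f x * U t x ≤ α ^ 2 * a ^ 2 + energy U t / 2 := by
      have : ∫ x in (0:ℝ)..1, f x * U t x
          ≤ ∫ x in (0:ℝ)..1, (α ^ 2 * a ^ 2 + energy U t / 2) := by
        refine intervalIntegral.integral_mono_on zero_le_one
          ((cf.mul cU).intervalIntegrable _ _) (by simp) fun x hx => ?_
        have U0 : U t 0 = 0 := by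
          refine intervalIntegral.integral_zero_ae (Filter.Eventually.of_forall fun s hs => ?_)
          rw [uIoc_of_le ht.1] at hs
          exact (hu.2.2 s ⟨hs.1.le, hs.2.trans ht.2⟩).1
        calc f x * U t x ≤ |f x| * |U t x| := by rw [← abs_mul]; exact le_abs_self _
          _ ≤ (α * a) * |U t x| := by gcongr; exact hfa x hx
          _ ≤ (α * a) ^ 2 + energy U t / 2 := hP.mul_abs_le_energy U0 hx (by positivity)
          _ = _ := by ring
      simpa using this
    have G0 : ∫ x in (0:ℝ)..1, f x * U 0 x = 0 := by simp [hU]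
    have Et : (1/2) * ∫ x in (0:ℝ)..1, (u t x) ^ 2 ≤ energy U t := by
      rw [hP.energy_eq]
      have := intervalIntegral.integral_nonneg (μ := volume) zero_le_one
        fun (x : ℝ) (_ : x ∈ Icc (0:ℝ) 1) =>
          sq_nonneg (∫ s in (0:ℝ)..t, pdx u s x)
      linarith
    have key' : energy U t - energy U 0 ≤
      (∫ x in (0:ℝ)..1, f x * U t x) - ∫ x in (0:ℝ)..1, f x * U 0 x := key
    linarith
  · have c := h.continuous.uncurry_left s
    have ct := h.continuous_t.uncurry_left s
    have cxx := hP.continuous_xx.uncurry_left s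
    refine intervalIntegral.integral_mono_on zero_le_one
      (Continuous.intervalIntegrable (by fun_prop) _ _) ((cf.mul c).intervalIntegrable _ _)
      fun x hx => ?_
    rw [hu.primitive_sub_eq hv hs hx]
    have : 0 ≤ α / (2*m+1) * ((u s x) ^ 2) ^ (m+1) := by positivity
    have e : u s x * (u s x) ^ (2*m+1) = ((u s x) ^ 2) ^ (m+1) := by
      rw [← pow_mul, ← pow_succ']; congr 1
    simp only [hf]
    linear_combination this - α / (2*m+1) * e

end IsClassicalSolution

/-- Comparison with the conservative problem: the difference between the damped solution
with data `((2/(kπ)) sin(kπx), 0)` and the free wave `w(t,x) = (2/(kπ)) cos(kπt) sin(kπx)`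
has energy at most `C T k^(-ε)`. -/
theorem comparison_with_conservative
    (α : ℝ) (hα : 0 < α) (m : ℕ) (hm : 1 ≤ m)
    (ε : ℝ) (hε : ε ∈ Ioo (0:ℝ) (1/2)) :
    ∃ C : ℝ, 0 < C ∧ ∀ k : ℕ, 1 ≤ k → ∀ T : ℝ, 0 < T → ∀ u : ℝ → ℝ → ℝ,
      IsClassicalSolution α m T u →
      (∀ x ∈ Icc (0:ℝ) 1, u 0 x = (2 / ((k:ℝ) * π)) * Real.sin ((k:ℝ) * π * x)) →
      (∀ x ∈ Icc (0:ℝ) 1, pdt u 0 x = 0) →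
      ∀ t ∈ Icc (0:ℝ) T,
        energy (fun s y =>
            u s y - (2 / ((k:ℝ) * π)) * Real.cos ((k:ℝ) * π * s) * Real.sin ((k:ℝ) * π * y)) t
          ≤ C * T * (k:ℝ) ^ (-ε) := by
  refine ⟨α * 4 ^ (m-1) * (2 + 4 * α ^ 2), by positivity, ?_⟩
  intro k hk T hT u hu hu0 hv t ht
  have hk1 : (1:ℝ) ≤ k := by exact_mod_cast hk
  have hk0 : (0:ℝ) < k := by linarith
  have hκ : (k:ℝ) * π ≠ 0 := by positivity
  set κ : ℝ := k * π with hκdef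
  have h := hu.hasPartialDerivs
  have hw := hasPartialDerivs_standingWave hκ
  have hz := h.sub hw
  set a : ℝ := (k:ℝ)⁻¹ with ha
  have ha0 : 0 ≤ a := by positivity
  have ha1 : a ≤ 1 := inv_le_one_of_one_le₀ hk1
  have hux (x : ℝ) (hx : x ∈ Icc (0:ℝ) 1) : pdx u 0 x = 2 * Real.cos (κ * x) := by
    have := hasDerivAt_eq_zero_of_eqOn_Icc (c := 0) zero_lt_one
      (fun y hy => by simp [hu0 y hy]) hx (hz.deriv_x 0 x)
    simpa [sub_eq_zero] using this
  have hEz : energy (fun s y => u s y - (2 / κ) * Real.cos (κ * s) * Real.sin (κ * y)) 0 = 0 := by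
    rw [hz.energy_eq, intervalIntegral.integral_zero_ae (.of_forall fun x hx => ?_),
      intervalIntegral.integral_zero_ae (.of_forall fun x hx => ?_)]
    · simp
    all_goals
      rw [uIoc_of_le zero_le_one] at hx
      simp [hv x (Ioc_subset_Icc_self hx), hux x (Ioc_subset_Icc_self hx)]
  have hEu : energy u 0 ≤ 2 := by
    rw [energy, intervalIntegral.integral_congr (g := fun x => (2 * Real.cos (κ * x)) ^ 2)
        fun x hx => ?_,
      intervalIntegral.integral_congr (f := fun x => (pdt u 0 x) ^ 2) (g := fun _ => 0)
        fun x hx => ?_]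
    · have : ∫ x in (0:ℝ)..1, (2 * Real.cos (κ * x)) ^ 2 ≤ ∫ x in (0:ℝ)..1, (4:ℝ) :=
        intervalIntegral.integral_mono_on zero_le_one
          (Continuous.intervalIntegrable (by fun_prop) _ _) (by simp)
          fun x _ => by nlinarith [Real.cos_sq_le_one (κ * x)]
      simp at this ⊢
      linarith
    · rw [uIcc_of_le zero_le_one] at hx
      simp [hv x hx]
    · rw [uIcc_of_le zero_le_one] at hx
      simp [hux x hx]
  have husup (s : ℝ) (hs : s ∈ Icc 0 T) (x : ℝ) (hx : x ∈ Icc (0:ℝ) 1) : |u s x| ≤ 2 := by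
    have := h.mul_abs_le_energy (hu.2.2 s hs).1 hx zero_le_one
    linarith [hu.energy_le hα.le hT hs]
  have hu0a (x : ℝ) (hx : x ∈ Icc (0:ℝ) 1) : |u 0 x| ≤ a := by
    rw [hu0 x hx, abs_mul, abs_of_pos (by positivity : 0 < 2 / κ)]
    calc 2 / κ * |Real.sin (κ * x)| ≤ 2 / κ * 1 := by gcongr; exact Real.abs_sin_le_one _
      _ = a * (2 / π) := by rw [hκdef, ha]; field_simp
      _ ≤ a * 1 := by gcongr; rw [div_le_one pi_pos]; exact two_le_pi
      _ = a := mul_one a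
  have key := hz.energy_sub_le (T := T)
    (G := fun s => s * (α * 4 ^ (m-1) * ((2 + 4 * α ^ 2) * a ^ 2)))
    (g := fun _ => α * 4 ^ (m-1) * ((2 + 4 * α ^ 2) * a ^ 2))
    (fun s hs => ?_) (fun s => by simpa using (hasDerivAt_id s).mul_const _) (fun s hs => ?_) ht
  · rw [hEz] at key
    have hpow : a ^ 2 ≤ (k:ℝ) ^ (-ε) := by
      rw [ha, inv_pow, ← Real.rpow_natCast, ← Real.rpow_neg hk0.le]
      exact Real.rpow_le_rpow_of_exponent_le hk1 (by push_cast; linarith [hε.2])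
    calc _ ≤ t * (α * 4 ^ (m-1) * ((2 + 4 * α ^ 2) * a ^ 2)) := by simpa using key
      _ ≤ T * (α * 4 ^ (m-1) * ((2 + 4 * α ^ 2) * (k:ℝ) ^ (-ε))) := by gcongr; exact ht.2
      _ = _ := by ring
  · have hsin : Real.sin κ = 0 := Real.sin_nat_mul_pi k
    simpa [hsin] using hu.pdt_boundary hT hs
  · have c := h.continuous.uncurry_left s
    have c1 := hz.continuous_t.uncurry_left s
    have c2 := hz.continuous_tt.uncurry_left s
    have c3 := hz.continuous_xx.uncurry_left s
    calc _ ≤ ∫ x in (0:ℝ)..1, α * 4 ^ (m-1) * (u s x) ^ 2 := by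
          refine intervalIntegral.integral_mono_on zero_le_one
            ((c1.mul (c2.sub c3)).intervalIntegrable _ _)
            (Continuous.intervalIntegrable (by fun_prop) _ _) fun x hx => ?_
          have e := hu.sub_eq hs hx
          have hb : (u s x) ^ (2*m) ≤ 4 ^ (m-1) * (u s x) ^ 2 := by
            obtain ⟨n, rfl⟩ := Nat.exists_eq_add_of_le' hm
            rw [Nat.add_sub_cancel, pow_mul, pow_succ]
            gcongr
            rw [← sq_abs]
            nlinarith [husup s hs x hx, abs_nonneg (u s x)]
          have hp : 0 ≤ (u s x) ^ (2*m) := by rw [pow_mul]; positivity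
          set q := -2 * Real.sin (κ * s) * Real.sin (κ * x) with hq
          have hq4 : q ^ 2 ≤ 4 := by
            rw [hq, mul_pow, mul_pow]
            nlinarith [Real.sin_sq_le_one (κ * s), Real.sin_sq_le_one (κ * x),
              sq_nonneg (Real.sin (κ * s)), sq_nonneg (Real.sin (κ * x))]
          calc _ = α * ((u s x) ^ (2*m) * (-(pdt u s x * (pdt u s x - q)))) := by
                linear_combination (pdt u s x - q) * e
            _ ≤ α * ((u s x) ^ (2*m) * 1) := by
                gcongr
                nlinarith [sq_nonneg (pdt u s x - q / 2)]
            _ ≤ α * (4 ^ (m-1) * (u s x) ^ 2) := by rw [mul_one]; gcongr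
            _ = _ := by ring
      _ = α * 4 ^ (m-1) * ∫ x in (0:ℝ)..1, (u s x) ^ 2 := intervalIntegral.integral_const_mul _ _
      _ ≤ _ := by
          gcongr
          exact hu.integral_sq_le hα.le ha0 ha1 hu0a hv hs
end

section
/- Global existence of smooth solutions for smooth compatible data: let u₀, u₁ : [0,1] → ℝ be restrictions of C^∞ functions such that for every integer j ≥ 0 the even-order derivatives satisfy u₀^(2j)(0) = u₀^(2j)(1) = 0 and u₁^(2j)(0) = u₁^(2j)(1) = 0. Then there exists a function u : [0,∞) × [0,1] → ℝ, infinitely differentiable jointly in (t,x), which is a classical solution of the degenerately damped wave equation on [0,T] for every T > 0 and satisfies u(0,x) = u₀(x) and ∂ₜu(0,x) = u₁(x) for all x ∈ [0,1]. -/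
open MeasureTheory Real Set

open scoped ContDiff Topology

/-- Quadratic Taylor remainder estimate on a bounded interval. -/
theorem exists_taylor_quadratic_bound {f : ℝ → ℝ} (hf : ContDiff ℝ ∞ f) (M : ℝ) :
    ∃ B : ℝ, ∀ x y : ℝ, |x| ≤ M → |y| ≤ M →
      |f y - f x - deriv f x * (y - x)| ≤ B * |y - x| ^ 2 := by
  have hd1 : ContDiff ℝ ∞ (deriv f) := (contDiff_infty_iff_deriv.1 hf).2
  have hd2 : Continuous (deriv (deriv f)) := hd1.continuous_deriv (by simp)
  obtain ⟨B, hB⟩ := (isCompact_Icc (a := -M) (b := M)).exists_bound_of_continuousOn hd2.continuousOn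
  refine ⟨B, fun x y hx hy => ?_⟩
  have hx' : x ∈ Icc (-M) M := abs_le.1 hx
  have hy' : y ∈ Icc (-M) M := abs_le.1 hy
  have hsub : uIcc x y ⊆ Icc (-M) M := uIcc_subset_Icc hx' hy'
  have hder : ∀ z ∈ uIcc x y, ‖deriv f z - deriv f x‖ ≤ B * |y - x| := by
    intro z hz
    have h1 := (convex_Icc (-M) M).norm_image_sub_le_of_norm_deriv_le (f := deriv f) (C := B)
      (fun w _ => (hd1.differentiable (by simp)).differentiableAt) hB hx' (hsub hz)
    refine h1.trans ?_
    have hB0 : 0 ≤ B := (norm_nonneg _).trans (hB x hx')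
    gcongr
    exact abs_sub_left_of_mem_uIcc hz
  have h2 := (convex_uIcc x y).norm_image_sub_le_of_norm_hasDerivWithin_le
    (f := fun z => f z - deriv f x * z) (f' := fun z => deriv f z - deriv f x)
    (fun z _ => by
      have := ((hf.differentiable (by simp)).differentiableAt (x := z)).hasDerivAt.sub
        ((hasDerivAt_id z).const_mul (deriv f x))
      rw [mul_one] at this
      exact this.hasDerivWithinAt) hder left_mem_uIcc right_mem_uIcc
  calc _ = ‖(f y - deriv f x * y) - (f x - deriv f x * x)‖ := by
        rw [Real.norm_eq_abs]; congr 1; ring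
    _ ≤ _ := h2
    _ = _ := by rw [Real.norm_eq_abs]; ring

section Superposition
variable {K : Type*} [TopologicalSpace K]

/-- The superposition operator `U ↦ f ∘ U` on continuous functions (with junk value `0` when `f` is
not continuous). -/
noncomputable def superposition (f : ℝ → ℝ) (U : C(K, ℝ)) : C(K, ℝ) :=
  open Classical in if hf : Continuous f then (ContinuousMap.mk f hf).comp U else 0

theorem superposition_apply {f : ℝ → ℝ} (hf : Continuous f) (U : C(K, ℝ)) (k : K) :
    superposition f U k = f (U k) := by
  simp [superposition, hf]

variable [CompactSpace K]

theorem hasFDerivAt_superposition {f : ℝ → ℝ} (hf : ContDiff ℝ ∞ f) (U : C(K, ℝ)) :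
    HasFDerivAt (superposition f)
      (ContinuousLinearMap.mul ℝ C(K, ℝ) (superposition (deriv f) U)) U := by
  obtain ⟨B, hB⟩ := exists_taylor_quadratic_bound hf (‖U‖ + 1)
  have hd1 : Continuous (deriv f) := hf.continuous_deriv (by simp)
  rw [hasFDerivAt_iff_isLittleO_nhds_zero]
  refine Asymptotics.IsBigO.trans_isLittleO (g := fun h : C(K, ℝ) => ‖h‖ ^ 2) ?_ ?_
  · refine Asymptotics.IsBigO.of_bound |B| ?_
    filter_upwards [Metric.ball_mem_nhds (0 : C(K, ℝ)) one_pos] with h hh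
    have hh1 : ‖h‖ ≤ 1 := by simpa using (mem_ball_zero_iff.1 hh).le
    rw [ContinuousMap.norm_le _ (by positivity)]
    intro k
    have h1 : |U k| ≤ ‖U‖ := U.norm_coe_le_norm k
    have h2 : |h k| ≤ ‖h‖ := h.norm_coe_le_norm k
    have := hB (U k) (U k + h k) (by linarith) ((abs_add_le _ _).trans (by linarith))
    simp only [ContinuousMap.sub_apply, superposition_apply hf.continuous, ContinuousMap.add_apply,
      ContinuousLinearMap.mul_apply', ContinuousMap.mul_apply, superposition_apply hd1,
      Real.norm_eq_abs, add_sub_cancel_left] at this ⊢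
    refine this.trans ?_
    rw [abs_of_nonneg (by positivity : (0:ℝ) ≤ ‖h‖ ^ 2)]
    exact mul_le_mul (le_abs_self B) (by gcongr) (by positivity) (abs_nonneg _)
  · exact Asymptotics.isLittleO_norm_pow_id one_lt_two

theorem contDiff_superposition {f : ℝ → ℝ} (hf : ContDiff ℝ ∞ f) :
    ContDiff ℝ ∞ (superposition (K := K) f) := by
  rw [contDiff_infty]
  intro n
  induction n generalizing f with
  | zero =>
    exact contDiff_zero.2 (continuous_iff_continuousAt.2 fun U =>
      (hasFDerivAt_superposition hf U).continuousAt)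
  | succ n ih =>
    refine contDiff_succ_iff_hasFDerivAt.2 ⟨_, ?_, hasFDerivAt_superposition hf⟩
    have hmul : ContDiff ℝ n fun V : C(K, ℝ) => ContinuousLinearMap.mul ℝ C(K, ℝ) V :=
      IsBoundedLinearMap.contDiff (ContinuousLinearMap.mul ℝ C(K, ℝ)).isBoundedLinearMap
    exact hmul.comp (ih (contDiff_infty_iff_deriv.1 hf).2)

end Superposition

/-- Fixed points of a smooth family of uniform contractions depend smoothly on the parameter. -/
theorem contDiffAt_fixedPoint {P X : Type*} [NormedAddCommGroup P] [NormedSpace ℝ P]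
    [CompleteSpace P] [NormedAddCommGroup X] [NormedSpace ℝ X] [CompleteSpace X]
    {Φ : P × X → X} (hΦ : ContDiff ℝ ∞ Φ) {K : NNReal} (hK : K < 1) {z₀ : P}
    (hlip : ∀ᶠ z in 𝓝 z₀, LipschitzWith K fun V => Φ (z, V)) {φ : P → X}
    (hφ : ∀ᶠ z in 𝓝 z₀, Φ (z, φ z) = φ z) : ContDiffAt ℝ ∞ φ z₀ := by
  set f : P × X → X := fun p => p.2 - Φ p with hf
  have hfc : ContDiffAt ℝ ∞ f (z₀, φ z₀) := (contDiff_snd.sub hΦ).contDiffAt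
  have hΦd : HasFDerivAt Φ (fderiv ℝ Φ (z₀, φ z₀)) (z₀, φ z₀) :=
    ((hΦ.differentiable (by simp)) _).hasFDerivAt
  have hpart : HasFDerivAt (fun V => Φ (z₀, V))
      (fderiv ℝ Φ (z₀, φ z₀) ∘L .inr ℝ P X) (φ z₀) :=
    hΦd.comp (φ z₀) (hasFDerivAt_prodMk_right z₀ (φ z₀))
  have hnorm : ‖fderiv ℝ Φ (z₀, φ z₀) ∘L .inr ℝ P X‖ < 1 :=
    (hpart.le_of_lipschitz hlip.self_of_nhds).trans_lt (by exact_mod_cast hK)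
  have hfd : fderiv ℝ f (z₀, φ z₀) ∘L .inr ℝ P X =
      1 - fderiv ℝ Φ (z₀, φ z₀) ∘L .inr ℝ P X := by
    have hfder : HasFDerivAt f (.snd ℝ P X - fderiv ℝ Φ (z₀, φ z₀)) (z₀, φ z₀) :=
      hasFDerivAt_snd.sub hΦd
    rw [hfder.fderiv]
    ext v; simp
  have hinv : (fderiv ℝ f (z₀, φ z₀) ∘L .inr ℝ P X).IsInvertible := by
    rw [hfd]
    exact ⟨ContinuousLinearEquiv.unitsEquiv ℝ X (Units.oneSub _ hnorm), rfl⟩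
  have hne : (∞ : WithTop ℕ∞) ≠ 0 := by simp
  have hz : f (z₀, φ z₀) = 0 := by simp [hf, hφ.self_of_nhds]
  refine (hfc.contDiffAt_implicitFunction hne hinv).congr_of_eventuallyEq ?_
  filter_upwards [hfc.eventually_apply_implicitFunction hne hinv, hlip, hφ] with z h1 h2 h3
  rw [hz] at h1
  have hc : ContractingWith K fun V => Φ (z, V) := ⟨hK, h2⟩
  exact hc.fixedPoint_unique' h3 (sub_eq_zero.1 h1).symm

/-- The normalised backward light cone with apex `(1, 0)` and base `{0} × [-1, 1]`. -/
def lightCone : Set (ℝ × ℝ) := {z | 0 ≤ z.1 ∧ z.1 ≤ 1 ∧ |z.2| ≤ 1 - z.1}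

theorem isCompact_lightCone : IsCompact lightCone := by
  refine IsCompact.of_isClosed_subset (isCompact_Icc (a := ((0, -1) : ℝ × ℝ)) (b := (1, 1))) ?_ ?_
  · exact (isClosed_le continuous_const continuous_fst).inter
      ((isClosed_le continuous_fst continuous_const).inter
        (isClosed_le continuous_snd.abs (continuous_const.sub continuous_fst)))
  · rintro ⟨θ, y⟩ ⟨h0, h1, h2⟩
    have := abs_le.1 h2
    simp only at h0 h1 this
    exact ⟨⟨h0, by simp only; linarith⟩, ⟨h1, by simp only; linarith⟩⟩

instance : CompactSpace lightCone := isCompact_iff_compactSpace.1 isCompact_lightCone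

/-- The apex of the normalised light cone. -/
def coneApex : lightCone := ⟨(1, 0), by simp [lightCone]⟩

/-- A continuous retraction of the plane onto the normalised light cone. -/
noncomputable def coneRetract (z : ℝ × ℝ) : lightCone :=
  ⟨(max 0 (min z.1 1),
    max (-(1 - max 0 (min z.1 1))) (min z.2 (1 - max 0 (min z.1 1)))), by
    have h1 : max 0 (min z.1 1) ≤ (1 : ℝ) := max_le zero_le_one (min_le_right _ _)
    refine ⟨le_max_left _ _, h1, abs_le.2 ⟨le_max_left _ _, max_le ?_ (min_le_right _ _)⟩⟩
    simp only; linarith⟩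

theorem continuous_coneRetract : Continuous coneRetract := by
  unfold coneRetract
  fun_prop

theorem coneRetract_of_mem {z : ℝ × ℝ} (hz : z ∈ lightCone) : coneRetract z = ⟨z, hz⟩ := by
  obtain ⟨h0, h1, h2⟩ := hz
  have h3 := abs_le.1 h2
  ext
  · simp [coneRetract, min_eq_left h1, max_eq_right h0]
  · simp [coneRetract, min_eq_left h1, max_eq_right h0, min_eq_left h3.2]
    linarith

theorem characteristic_mem_lightCone {ε : ℝ} (hε : |ε| ≤ 1) (d : lightCone) {τ : ℝ}
    (hτ : τ ∈ Icc 0 d.1.1) : (τ, d.1.2 + ε * (d.1.1 - τ)) ∈ lightCone := by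
  obtain ⟨⟨θ, y⟩, h0, h1, h2⟩ := d
  simp only [mem_Icc] at h0 h1 h2 hτ
  refine ⟨hτ.1, hτ.2.trans h1, (abs_add_le _ _).trans ?_⟩
  have : |ε * (θ - τ)| ≤ 1 * (θ - τ) := by
    rw [abs_mul, abs_of_nonneg (sub_nonneg.2 hτ.2)]
    exact mul_le_mul_of_nonneg_right hε (sub_nonneg.2 hτ.2)
  simp only at this ⊢
  linarith

/-- Integral of `h` along the backward characteristic of speed `ε` from a point of the cone. -/
noncomputable def transportFun (ε : ℝ) (h : C(lightCone, ℝ)) (d : lightCone) : ℝ :=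
  ∫ τ in (0 : ℝ)..d.1.1, h (coneRetract (τ, d.1.2 + ε * (d.1.1 - τ)))

theorem continuous_transport_integrand (ε : ℝ) (h : C(lightCone, ℝ)) :
    Continuous fun p : lightCone × ℝ => h (coneRetract (p.2, p.1.1.2 + ε * (p.1.1.1 - p.2))) := by
  have := continuous_coneRetract
  fun_prop

theorem continuous_transportFun (ε : ℝ) (h : C(lightCone, ℝ)) :
    Continuous (transportFun ε h) :=
  intervalIntegral.continuous_parametric_intervalIntegral_of_continuous
    (continuous_transport_integrand ε h) (by fun_prop)

theorem intervalIntegrable_transport (ε : ℝ) (h : C(lightCone, ℝ)) (d : lightCone) (a b : ℝ) :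
    IntervalIntegrable (fun τ => h (coneRetract (τ, d.1.2 + ε * (d.1.1 - τ)))) volume a b :=
  ((continuous_transport_integrand ε h).comp (Continuous.prodMk_right d)).intervalIntegrable a b

theorem transportFun_eq {ε : ℝ} (hε : |ε| ≤ 1) (h : C(lightCone, ℝ)) (d : lightCone)
    {f : ℝ → ℝ} (hf : ∀ τ, ∀ hτ : τ ∈ Icc 0 d.1.1,
      h ⟨(τ, d.1.2 + ε * (d.1.1 - τ)), characteristic_mem_lightCone hε d hτ⟩ = f τ) :
    transportFun ε h d = ∫ τ in (0 : ℝ)..d.1.1, f τ := by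
  refine intervalIntegral.integral_congr fun τ hτ => ?_
  rw [uIcc_of_le d.2.1] at hτ
  rw [coneRetract_of_mem (characteristic_mem_lightCone hε d hτ), hf τ hτ]

theorem abs_transportFun_le_weighted {ε : ℝ} (hε : |ε| ≤ 1) {h : C(lightCone, ℝ)} {c k : ℝ}
    (hk : 0 < k) (hh : ∀ d : lightCone, |h d| ≤ c * exp (k * d.1.1)) (d : lightCone) :
    |transportFun ε h d| ≤ c / k * exp (k * d.1.1) := by
  have hc : 0 ≤ c := nonneg_of_mul_nonneg_left ((abs_nonneg _).trans (hh d)) (exp_pos _)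
  have hint : ∫ τ in (0 : ℝ)..d.1.1, c * exp (k * τ) = c / k * (exp (k * d.1.1) - 1) := by
    rw [intervalIntegral.integral_const_mul, intervalIntegral.integral_comp_mul_left _ hk.ne']
    simp [integral_exp]
    ring
  have hi : IntervalIntegrable (fun τ => c * exp (k * τ)) volume 0 d.1.1 :=
    Continuous.intervalIntegrable (by fun_prop) _ _
  have h1 : |transportFun ε h d| ≤ ∫ τ in (0 : ℝ)..d.1.1, c * exp (k * τ) := by
    rw [← Real.norm_eq_abs, transportFun]
    refine intervalIntegral.norm_integral_le_of_norm_le d.2.1 ?_ hi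
    refine Filter.Eventually.of_forall fun τ hτ => ?_
    have hm := characteristic_mem_lightCone hε d ⟨hτ.1.le, hτ.2⟩
    rw [coneRetract_of_mem hm]
    exact hh ⟨_, hm⟩
  rw [hint] at h1
  refine h1.trans (mul_le_mul_of_nonneg_left (by linarith) (by positivity))

theorem abs_transportFun_le (ε : ℝ) (h : C(lightCone, ℝ)) (d : lightCone) :
    |transportFun ε h d| ≤ ‖h‖ := by
  have h1 := intervalIntegral.norm_integral_le_of_norm_le_const (a := 0) (b := d.1.1)
    (f := fun τ => h (coneRetract (τ, d.1.2 + ε * (d.1.1 - τ)))) (C := ‖h‖)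
    fun τ _ => h.norm_coe_le_norm _
  refine h1.trans (mul_le_of_le_one_right (norm_nonneg _) ?_)
  rw [sub_zero, abs_of_nonneg d.2.1]
  exact d.2.2.1

/-- Integration along backward characteristics of speed `ε`, as a bounded operator. -/
noncomputable def transport (ε : ℝ) : C(lightCone, ℝ) →L[ℝ] C(lightCone, ℝ) :=
  LinearMap.mkContinuous
    { toFun := fun h => ⟨transportFun ε h, continuous_transportFun ε h⟩
      map_add' := fun h₁ h₂ => by
        ext d
        exact intervalIntegral.integral_add (intervalIntegrable_transport ε h₁ d _ _)
          (intervalIntegrable_transport ε h₂ d _ _)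
      map_smul' := fun c h => by
        ext d
        exact intervalIntegral.integral_smul c _ }
    1 fun h => by
      rw [one_mul, ContinuousMap.norm_le _ (norm_nonneg _)]
      exact abs_transportFun_le ε h

theorem transport_apply (ε : ℝ) (h : C(lightCone, ℝ)) (d : lightCone) :
    transport ε h d = transportFun ε h d := rfl

/-- The Duhamel operator of the integrated damping term. -/
noncomputable def duhamel : C(lightCone, ℝ) →L[ℝ] C(lightCone, ℝ) :=
  (-(1 / 2) : ℝ) • (transport 1 + transport (-1))

theorem duhamel_apply (h : C(lightCone, ℝ)) (d : lightCone) :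
    duhamel h d = -(1 / 2) * (transportFun 1 h d + transportFun (-1) h d) := by
  simp [duhamel, transport_apply]
  ring

theorem abs_duhamel_le_weighted {h : C(lightCone, ℝ)} {c k : ℝ}
    (hk : 0 < k) (hh : ∀ d : lightCone, |h d| ≤ c * exp (k * d.1.1)) (d : lightCone) :
    |duhamel h d| ≤ c / k * exp (k * d.1.1) := by
  have h1 := abs_transportFun_le_weighted (ε := 1) (by simp) hk hh d
  have h2 := abs_transportFun_le_weighted (ε := -1) (by simp) hk hh d
  rw [duhamel_apply, abs_mul]
  have h3 := (abs_add_le (transportFun 1 h d) (transportFun (-1) h d)).trans (add_le_add h1 h2)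
  norm_num
  linarith

/-- The time coordinate on the cone. -/
def coneTime : C(lightCone, ℝ) := ⟨fun d => d.1.1, by fun_prop⟩

/-- The space coordinate on the cone. -/
def coneSpace : C(lightCone, ℝ) := ⟨fun d => d.1.2, by fun_prop⟩

/-- The free wave `a (x + t) + b (x - t)` on the backward light cone from `z`, rescaled to
`lightCone`. -/
noncomputable def coneData (a b : ℝ → ℝ) (z : ℝ × ℝ) : C(lightCone, ℝ) :=
  superposition a (z.2 • 1 + z.1 • (coneSpace + coneTime)) +
    superposition b (z.2 • 1 + z.1 • (coneSpace - coneTime))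

theorem coneData_apply {a b : ℝ → ℝ} (ha : Continuous a) (hb : Continuous b) (z : ℝ × ℝ)
    (d : lightCone) : coneData a b z d =
      a (z.2 + z.1 * (d.1.2 + d.1.1)) + b (z.2 + z.1 * (d.1.2 - d.1.1)) := by
  simp [coneData, superposition_apply, ha, hb, coneSpace, coneTime, mul_add, mul_sub]

theorem contDiff_coneData {a b : ℝ → ℝ} (ha : ContDiff ℝ ∞ a) (hb : ContDiff ℝ ∞ b) :
    ContDiff ℝ ∞ (coneData a b) := by
  have h (W : C(lightCone, ℝ)) : ContDiff ℝ ∞ fun z : ℝ × ℝ =>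
      z.2 • (1 : C(lightCone, ℝ)) + z.1 • W := by fun_prop
  exact ((contDiff_superposition ha).comp (h _)).add ((contDiff_superposition hb).comp (h _))

/-- The weight `exp (k θ)` on the cone. -/
noncomputable def coneWeight (k : ℝ) : C(lightCone, ℝ) := ⟨fun d => exp (k * d.1.1), by fun_prop⟩

theorem coneWeight_apply (k : ℝ) (d : lightCone) : coneWeight k d = exp (k * d.1.1) := rfl

theorem coneWeight_neg_mul (k : ℝ) : coneWeight (-k) * coneWeight k = 1 := by
  ext d
  simp [coneWeight_apply, ← exp_add]

/-- The map whose fixed points are the rescaled mild solutions on backward light cones. -/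
noncomputable def coneMap (a b G : ℝ → ℝ) (z : ℝ × ℝ) (U : C(lightCone, ℝ)) : C(lightCone, ℝ) :=
  coneData a b z + z.1 • duhamel (superposition G U)

/-- `coneMap` conjugated by an exponential weight. -/
noncomputable def weightedConeMap (k : ℝ) (a b G : ℝ → ℝ) (p : (ℝ × ℝ) × C(lightCone, ℝ)) :
    C(lightCone, ℝ) :=
  coneWeight (-k) * coneMap a b G p.1 (coneWeight k * p.2)

theorem contDiff_weightedConeMap (k : ℝ) {a b G : ℝ → ℝ} (ha : ContDiff ℝ ∞ a)
    (hb : ContDiff ℝ ∞ b) (hG : ContDiff ℝ ∞ G) : ContDiff ℝ ∞ (weightedConeMap k a b G) := by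
  have h1 : ContDiff ℝ ∞ fun p : (ℝ × ℝ) × C(lightCone, ℝ) =>
      duhamel (superposition G (coneWeight k * p.2)) :=
    duhamel.contDiff.comp ((contDiff_superposition hG).comp (contDiff_const.mul contDiff_snd))
  have h2 : ContDiff ℝ ∞ fun p : (ℝ × ℝ) × C(lightCone, ℝ) => coneData a b p.1 :=
    (contDiff_coneData ha hb).comp contDiff_fst
  unfold weightedConeMap coneMap
  fun_prop

theorem lipschitzWith_weightedConeMap {k : ℝ} (hk : 0 < k) {a b G : ℝ → ℝ} {C : NNReal}
    (hG : LipschitzWith C G) {z : ℝ × ℝ} (hz : 2 * C * |z.1| ≤ k) :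
    LipschitzWith (1 / 2) fun V => weightedConeMap k a b G (z, V) := by
  refine LipschitzWith.of_dist_le_mul fun V W => ?_
  rw [dist_eq_norm, dist_eq_norm, ContinuousMap.norm_le _ (by positivity)]
  intro d
  set h := superposition G (coneWeight k * V) - superposition G (coneWeight k * W) with hh
  have hdiff : weightedConeMap k a b G (z, V) - weightedConeMap k a b G (z, W) =
      coneWeight (-k) * (z.1 • duhamel h) := by
    rw [hh, map_sub, smul_sub]
    simp only [weightedConeMap, coneMap]
    ring
  have hbd : ∀ d : lightCone, |h d| ≤ C * ‖V - W‖ * exp (k * d.1.1) := by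
    intro d
    have h1 := hG.dist_le_mul (exp (k * d.1.1) * V d) (exp (k * d.1.1) * W d)
    have h2 : |V d - W d| ≤ ‖V - W‖ := (V - W).norm_coe_le_norm d
    rw [Real.dist_eq, Real.dist_eq, ← mul_sub, abs_mul, abs_of_pos (exp_pos _)] at h1
    simp only [hh, ContinuousMap.sub_apply, superposition_apply hG.continuous,
      ContinuousMap.mul_apply, coneWeight_apply]
    refine h1.trans ?_
    rw [mul_assoc, mul_comm (‖V - W‖)]
    gcongr
  have h3 := abs_duhamel_le_weighted hk hbd d
  rw [hdiff, Real.norm_eq_abs]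
  simp only [ContinuousMap.mul_apply, coneWeight_apply, ContinuousMap.smul_apply, smul_eq_mul,
    abs_mul, abs_of_pos (exp_pos _)]
  calc exp (-k * d.1.1) * (|z.1| * |duhamel h d|)
      ≤ exp (-k * d.1.1) * (|z.1| * (C * ‖V - W‖ / k * exp (k * d.1.1))) := by gcongr
    _ = (exp (-k * d.1.1) * exp (k * d.1.1)) * (C * |z.1| / k) * ‖V - W‖ := by ring
    _ = (C * |z.1| / k) * ‖V - W‖ := by rw [← exp_add]; simp
    _ ≤ (1 / 2) * ‖V - W‖ := by
        refine mul_le_mul_of_nonneg_right ?_ (norm_nonneg _)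
        rw [div_le_iff₀ hk]
        linarith
    _ = _ := by simp

theorem weightedConeMap_eq_iff (k : ℝ) (a b G : ℝ → ℝ) (z : ℝ × ℝ) (U : C(lightCone, ℝ)) :
    weightedConeMap k a b G (z, coneWeight (-k) * U) = coneWeight (-k) * U ↔
      coneMap a b G z U = U := by
  have h1 : coneWeight k * (coneWeight (-k) * U) = U := by
    rw [← mul_assoc, mul_comm (coneWeight k), coneWeight_neg_mul, one_mul]
  simp only [weightedConeMap, h1]
  refine ⟨fun h => ?_, fun h => by rw [h]⟩
  rw [← h, ← mul_assoc, mul_comm (coneWeight k), coneWeight_neg_mul, one_mul] at h1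
  exact h1

theorem existsUnique_coneMap_fixedPoint (a b : ℝ → ℝ) {G : ℝ → ℝ} {C : NNReal}
    (hG : LipschitzWith C G) (z : ℝ × ℝ) : ∃! U, coneMap a b G z U = U := by
  set k : ℝ := 2 * C * |z.1| + 1
  have hc : ContractingWith (1 / 2) fun V => weightedConeMap k a b G (z, V) :=
    ⟨NNReal.half_lt_self one_ne_zero, lipschitzWith_weightedConeMap (by positivity) hG (by simp [k])⟩
  have hcan (V : C(lightCone, ℝ)) : coneWeight (-k) * (coneWeight k * V) = V := by
    rw [← mul_assoc, coneWeight_neg_mul, one_mul]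
  refine ⟨coneWeight k * hc.fixedPoint, ?_, fun U hU => ?_⟩
  · refine (weightedConeMap_eq_iff k a b G z _).1 ?_
    rw [hcan]
    exact hc.fixedPoint_isFixedPt
  · have := hc.fixedPoint_unique ((weightedConeMap_eq_iff k a b G z U).2 hU)
    rw [← this, ← mul_assoc, mul_comm (coneWeight k), coneWeight_neg_mul, one_mul]

theorem contDiff_coneMap_fixedPoint {a b G : ℝ → ℝ} (ha : ContDiff ℝ ∞ a) (hb : ContDiff ℝ ∞ b)
    (hGs : ContDiff ℝ ∞ G) {C : NNReal} (hG : LipschitzWith C G) {φ : ℝ × ℝ → C(lightCone, ℝ)}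
    (hφ : ∀ z, coneMap a b G z (φ z) = φ z) : ContDiff ℝ ∞ φ := by
  rw [contDiff_iff_contDiffAt]
  intro z₀
  set k : ℝ := 2 * C * (|z₀.1| + 1) + 1
  have hev : ∀ᶠ z : ℝ × ℝ in 𝓝 z₀, |z.1| < |z₀.1| + 1 :=
    continuous_fst.abs.continuousAt.eventually_lt_const (lt_add_one _)
  have h := contDiffAt_fixedPoint (contDiff_weightedConeMap k ha hb hGs)
    (NNReal.half_lt_self one_ne_zero) (z₀ := z₀) (φ := fun z => coneWeight (-k) * φ z)
    (by
      filter_upwards [hev] with z hz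
      refine lipschitzWith_weightedConeMap (by positivity) hG ?_
      have : 2 * (C : ℝ) * |z.1| ≤ 2 * C * (|z₀.1| + 1) := by gcongr
      linarith)
    (Filter.Eventually.of_forall fun z => (weightedConeMap_eq_iff k a b G z _).2 (hφ z))
  have h2 : φ = fun z => coneWeight k * (coneWeight (-k) * φ z) := by
    ext1 z
    rw [← mul_assoc, mul_comm (coneWeight k), coneWeight_neg_mul, one_mul]
  rw [h2]
  exact contDiffAt_const.mul h

/-- The affine embedding of the normalised light cone onto the sub-cone with apex `d`. -/
noncomputable def subcone (d : lightCone) : C(lightCone, lightCone) where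
  toFun e := ⟨(d.1.1 * e.1.1, d.1.2 + d.1.1 * e.1.2), by
    obtain ⟨⟨θ, y⟩, h0, h1, h2⟩ := d
    obtain ⟨⟨η, w⟩, h3, h4, h5⟩ := e
    simp only at h0 h1 h2 h3 h4 h5 ⊢
    refine ⟨mul_nonneg h0 h3, mul_le_one₀ h1 h3 h4, (abs_add_le _ _).trans ?_⟩
    simp only
    rw [abs_mul, abs_of_nonneg h0]
    have := mul_le_mul_of_nonneg_left h5 h0
    linarith⟩
  continuous_toFun := by fun_prop

theorem subcone_coneApex (d : lightCone) : subcone d coneApex = d := by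
  ext <;> simp [subcone, coneApex]

/-- The reflection of the normalised light cone in space. -/
noncomputable def coneReflection : C(lightCone, lightCone) where
  toFun e := ⟨(e.1.1, -e.1.2), e.2.1, e.2.2.1, by simpa using e.2.2.2⟩
  continuous_toFun := by fun_prop

theorem transportFun_subcone {ε : ℝ} (hε : |ε| ≤ 1) (h : C(lightCone, ℝ)) (d e : lightCone) :
    transportFun ε h (subcone d e) = d.1.1 * transportFun ε (h.comp (subcone d)) e := by
  rw [transportFun_eq hε (h.comp (subcone d)) e
    (f := fun σ => (fun τ => h (coneRetract
      (τ, (subcone d e).1.2 + ε * ((subcone d e).1.1 - τ)))) (d.1.1 * σ))]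
  · refine Eq.trans ?_ (intervalIntegral.smul_integral_comp_mul_left (fun τ => h (coneRetract
      (τ, (subcone d e).1.2 + ε * ((subcone d e).1.1 - τ)))) d.1.1).symm
    rw [mul_zero]
    rfl
  · intro σ hσ
    have hm : (d.1.1 * σ, (subcone d e).1.2 + ε * ((subcone d e).1.1 - d.1.1 * σ)) ∈ lightCone :=
      characteristic_mem_lightCone hε _
        ⟨mul_nonneg d.2.1 hσ.1, mul_le_mul_of_nonneg_left hσ.2 d.2.1⟩
    simp only [ContinuousMap.comp_apply, coneRetract_of_mem hm]
    congr 1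
    ext
    · simp [subcone]
    · simp [subcone]
      ring

theorem transportFun_coneReflection {ε : ℝ} (hε : |ε| ≤ 1) (h : C(lightCone, ℝ)) (e : lightCone) :
    transportFun ε h (coneReflection e) = transportFun (-ε) (h.comp coneReflection) e := by
  have hε' : |(-ε)| ≤ 1 := by rwa [abs_neg]
  rw [transportFun_eq hε' (h.comp coneReflection) e
    (f := fun τ => h (coneRetract
      (τ, (coneReflection e).1.2 + ε * ((coneReflection e).1.1 - τ))))]
  · rfl
  · intro τ hτ
    have hm : (τ, (coneReflection e).1.2 + ε * ((coneReflection e).1.1 - τ)) ∈ lightCone :=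
      characteristic_mem_lightCone hε _ hτ
    simp only [ContinuousMap.comp_apply, coneRetract_of_mem hm]
    congr 1
    ext
    · simp [coneReflection]
    · simp [coneReflection]
      ring

section Covariance
variable {a b G : ℝ → ℝ} (ha : Continuous a) (hb : Continuous b)
include ha hb

theorem coneMap_apply (z : ℝ × ℝ) (U : C(lightCone, ℝ)) (d : lightCone) :
    coneMap a b G z U d = a (z.2 + z.1 * (d.1.2 + d.1.1)) + b (z.2 + z.1 * (d.1.2 - d.1.1)) +
      z.1 * (-(1 / 2) * (transportFun 1 (superposition G U) d +
        transportFun (-1) (superposition G U) d)) := by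
  simp [coneMap, coneData_apply ha hb, duhamel_apply]

variable (hG : Continuous G)
include hG

theorem coneMap_comp_subcone (z : ℝ × ℝ) (U : C(lightCone, ℝ)) (d : lightCone) :
    coneMap a b G (z.1 * d.1.1, z.2 + z.1 * d.1.2) (U.comp (subcone d)) =
      (coneMap a b G z U).comp (subcone d) := by
  have hs : superposition G (U.comp (subcone d)) = (superposition G U).comp (subcone d) := by
    ext e
    simp [superposition_apply hG]
  ext e
  rw [ContinuousMap.comp_apply, coneMap_apply ha hb, coneMap_apply ha hb, hs,
    transportFun_subcone (by simp), transportFun_subcone (by simp)]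
  simp only [subcone, ContinuousMap.coe_mk]
  congr 1
  · congr 2 <;> ring
  · ring

theorem coneMap_reflection {c : ℝ} (hab : ∀ s, b (2 * c - s) = -a s) (hodd : ∀ s, G (-s) = -G s)
    (z : ℝ × ℝ) (U : C(lightCone, ℝ)) :
    coneMap a b G z (-U.comp coneReflection) =
      -(coneMap a b G (z.1, 2 * c - z.2) U).comp coneReflection := by
  have hs : superposition G (-U.comp coneReflection) =
      -(superposition G U).comp coneReflection := by
    ext e
    simp [superposition_apply hG, hodd]
  have hneg (ε : ℝ) (h : C(lightCone, ℝ)) (d : lightCone) :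
      transportFun ε (-h) d = -transportFun ε h d := by
    simp only [← transport_apply, map_neg, ContinuousMap.neg_apply]
  ext e
  rw [ContinuousMap.neg_apply, ContinuousMap.comp_apply, coneMap_apply ha hb,
    coneMap_apply ha hb, hs, hneg, hneg, transportFun_coneReflection (by simp),
    transportFun_coneReflection (by simp), neg_neg]
  have h1 := hab (z.2 + z.1 * (e.1.2 + e.1.1))
  have h2 := hab (2 * c - (z.2 + z.1 * (e.1.2 - e.1.1)))
  rw [sub_sub_cancel] at h2
  have h3 : 2 * c - z.2 + z.1 * (-e.1.2 + e.1.1) =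
      2 * c - (z.2 + z.1 * (e.1.2 - e.1.1)) := by ring
  have h4 : 2 * c - z.2 + z.1 * (-e.1.2 - e.1.1) =
      2 * c - (z.2 + z.1 * (e.1.2 + e.1.1)) := by ring
  simp only [coneReflection, ContinuousMap.coe_mk]
  rw [h2, h3, h4, h1]
  ring

end Covariance

/-- The integral of `h` along the characteristic of speed `ε` from the initial line to `z`. -/
noncomputable def charIntegral (ε : ℝ) (h : ℝ × ℝ → ℝ) (z : ℝ × ℝ) : ℝ :=
  ∫ τ in (0 : ℝ)..z.1, h (τ, z.2 + ε * (z.1 - τ))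

/-- Global smooth mild solutions of the integrated damped wave equation with Lipschitz damping,
together with the reflection symmetry they inherit from the data. -/
theorem exists_smooth_mild_solution {a b G : ℝ → ℝ} (ha : ContDiff ℝ ∞ a) (hb : ContDiff ℝ ∞ b)
    (hGs : ContDiff ℝ ∞ G) {C : NNReal} (hG : LipschitzWith C G) :
    ∃ u : ℝ × ℝ → ℝ, ContDiff ℝ ∞ u ∧
      (∀ ε : ℝ, |ε| ≤ 1 → ContDiff ℝ ∞ (charIntegral ε (G ∘ u))) ∧
      (∀ z, u z = a (z.2 + z.1) + b (z.2 - z.1) -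
        1 / 2 * (charIntegral 1 (G ∘ u) z + charIntegral (-1) (G ∘ u) z)) ∧
      ∀ c : ℝ, (∀ s, b (2 * c - s) = -a s) → (∀ s, G (-s) = -G s) →
        ∀ t x, u (t, 2 * c - x) = -u (t, x) := by
  choose φ hφ hφu using existsUnique_coneMap_fixedPoint a b hG
  simp only at hφ hφu
  have hφs : ContDiff ℝ ∞ φ := contDiff_coneMap_fixedPoint ha hb hGs hG hφ
  have hsub (z : ℝ × ℝ) (d : lightCone) :
      φ z d = φ (z.1 * d.1.1, z.2 + z.1 * d.1.2) coneApex := by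
    rw [← hφu (z.1 * d.1.1, z.2 + z.1 * d.1.2) ((φ z).comp (subcone d)) (by
      rw [coneMap_comp_subcone ha.continuous hb.continuous hGs.continuous, hφ]),
      ContinuousMap.comp_apply, subcone_coneApex]
  have hchar (ε : ℝ) (hε : |ε| ≤ 1) (z : ℝ × ℝ) :
      charIntegral ε (G ∘ fun z => φ z coneApex) z =
        z.1 * transport ε (superposition G (φ z)) coneApex := by
    rw [transport_apply, transportFun_eq hε (superposition G (φ z)) coneApex
      (f := fun σ => (fun τ => G (φ (τ, z.2 + ε * (z.1 - τ)) coneApex)) (z.1 * σ))]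
    · refine Eq.trans ?_ (intervalIntegral.smul_integral_comp_mul_left
        (fun τ => G (φ (τ, z.2 + ε * (z.1 - τ)) coneApex)) z.1).symm
      simp [charIntegral, coneApex]
    · intro τ hτ
      rw [superposition_apply hGs.continuous, hsub]
      simp only [coneApex]
      congr 4
      ring
  refine ⟨fun z => φ z coneApex, ?_, fun ε hε => ?_, fun z => ?_, fun c hab hodd t x => ?_⟩
  · exact (ContinuousMap.evalCLM ℝ coneApex).contDiff.comp hφs
  · rw [funext (hchar ε hε)]
    refine contDiff_fst.mul ?_
    exact (ContinuousMap.evalCLM ℝ coneApex).contDiff.comp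
      ((transport ε).contDiff.comp ((contDiff_superposition hGs).comp hφs))
  · rw [hchar 1 (by simp), hchar (-1) (by simp), transport_apply, transport_apply]
    have := congrArg (fun U : C(lightCone, ℝ) => U coneApex) (hφ z)
    simp only [coneMap_apply ha.continuous hb.continuous] at this
    refine this.symm.trans ?_
    simp only [coneApex]
    ring_nf
  · have h := hφu (t, x) (-(φ (t, 2 * c - x)).comp coneReflection) (by
      rw [coneMap_reflection ha.continuous hb.continuous hGs.continuous hab hodd, hφ])
    have h2 : coneReflection coneApex = coneApex := by ext <;> simp [coneReflection, coneApex]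
    simp only [← h]
    simp [h2]

/-- The directional derivative of `f` in the constant direction `w`. -/
noncomputable def dirDeriv (w : ℝ × ℝ) (f : ℝ × ℝ → ℝ) (z : ℝ × ℝ) : ℝ := fderiv ℝ f z w

theorem ContDiff.dirDeriv {f : ℝ × ℝ → ℝ} (hf : ContDiff ℝ ∞ f) (w : ℝ × ℝ) :
    ContDiff ℝ ∞ (dirDeriv w f) :=
  (hf.fderiv_right (m := ∞) (by simp)).clm_apply contDiff_const

theorem dirDeriv_eq_of_hasDerivAt {f : ℝ × ℝ → ℝ} (hf : ContDiff ℝ ∞ f) {w z : ℝ × ℝ} {c : ℝ}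
    (h : HasDerivAt (fun s : ℝ => f (z + s • w)) c 0) : dirDeriv w f z = c := by
  have h1 : HasFDerivAt f (fderiv ℝ f z) (z + (0 : ℝ) • w) := by
    simpa using ((hf.differentiable (by simp)) z).hasFDerivAt
  have h2 : HasDerivAt (fun s : ℝ => z + s • w) w 0 := by
    simpa using ((hasDerivAt_id (0 : ℝ)).smul_const w).const_add z
  exact (h1.comp_hasDerivAt 0 h2).unique h

theorem dirDeriv_comm {f : ℝ × ℝ → ℝ} (hf : ContDiff ℝ ∞ f) (v w : ℝ × ℝ) :
    dirDeriv v (dirDeriv w f) = dirDeriv w (dirDeriv v f) := by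
  have hd : Differentiable ℝ (fderiv ℝ f) :=
    (hf.fderiv_right (m := ∞) (by simp)).differentiable (by simp)
  have h (v w z : ℝ × ℝ) : dirDeriv v (dirDeriv w f) z = fderiv ℝ (fderiv ℝ f) z v w := by
    have := (hd z).hasFDerivAt.clm_apply (hasFDerivAt_const w z)
    rw [dirDeriv, show dirDeriv w f = fun z => fderiv ℝ f z w from rfl, this.fderiv]
    simp
  ext z
  rw [h, h]
  exact ((contDiff_infty.1 hf 2).contDiffAt.isSymmSndFDerivAt (by simp)).eq v w

theorem dirDeriv_lincomb {f g : ℝ × ℝ → ℝ} (hf : ContDiff ℝ ∞ f) (hg : ContDiff ℝ ∞ g) (c : ℝ)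
    (w : ℝ × ℝ) :
    dirDeriv w (fun z => f z + c * g z) = fun z => dirDeriv w f z + c * dirDeriv w g z := by
  ext z
  have h1 := ((hf.differentiable (by simp)) z).hasFDerivAt
  have h2 := (((hg.differentiable (by simp)) z).hasFDerivAt).const_mul c
  have h3 : HasFDerivAt (fun z => f z + c * g z) (fderiv ℝ f z + c • fderiv ℝ g z) z := h1.add h2
  rw [dirDeriv, h3.fderiv]
  simp [dirDeriv]

theorem dirDeriv_one_eq (ε : ℝ) (f : ℝ × ℝ → ℝ) :
    dirDeriv (1, ε) f = fun z => dirDeriv (1, 0) f z + ε * dirDeriv (0, 1) f z := by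
  ext z
  have : ((1, ε) : ℝ × ℝ) = (1, 0) + ε • (0, 1) := by simp
  rw [dirDeriv, this, map_add, map_smul]
  rfl

theorem pdt_curry {f : ℝ × ℝ → ℝ} (hf : ContDiff ℝ ∞ f) :
    pdt (Function.curry f) = Function.curry (dirDeriv (1, 0) f) := by
  ext t x
  have h1 := ((hf.differentiable (by simp)) (t, x)).hasFDerivAt
  exact (h1.comp_hasDerivAt t ((hasDerivAt_id t).prodMk (hasDerivAt_const t x))).deriv

theorem pdx_curry {f : ℝ × ℝ → ℝ} (hf : ContDiff ℝ ∞ f) :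
    pdx (Function.curry f) = Function.curry (dirDeriv (0, 1) f) := by
  ext t x
  have h1 := ((hf.differentiable (by simp)) (t, x)).hasFDerivAt
  exact (h1.comp_hasDerivAt x ((hasDerivAt_const x t).prodMk (hasDerivAt_id x))).deriv

/-- The wave operator in factored form. -/
theorem dirDeriv_null_null {f : ℝ × ℝ → ℝ} (hf : ContDiff ℝ ∞ f) (z : ℝ × ℝ) :
    dirDeriv (1, 1) (dirDeriv (1, -1) f) z =
      dirDeriv (1, 0) (dirDeriv (1, 0) f) z - dirDeriv (0, 1) (dirDeriv (0, 1) f) z := by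
  rw [dirDeriv_one_eq 1, dirDeriv_one_eq (-1), dirDeriv_lincomb (hf.dirDeriv _) (hf.dirDeriv _),
    dirDeriv_lincomb (hf.dirDeriv _) (hf.dirDeriv _), dirDeriv_comm hf (0, 1) (1, 0)]
  ring

theorem dirDeriv_charIntegral {ε : ℝ} {h : ℝ × ℝ → ℝ} (hh : Continuous h)
    (hI : ContDiff ℝ ∞ (charIntegral ε h)) : dirDeriv (1, -ε) (charIntegral ε h) = h := by
  ext z
  refine dirDeriv_eq_of_hasDerivAt hI ?_
  have hc : Continuous fun τ : ℝ => h (τ, z.2 + ε * (z.1 - τ)) := by fun_prop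
  have h1 : HasDerivAt (fun s : ℝ => ∫ τ in (0 : ℝ)..s, h (τ, z.2 + ε * (z.1 - τ))) (h z)
      (z.1 + 0) := by
    have := intervalIntegral.integral_hasDerivAt_right (hc.intervalIntegrable 0 z.1)
      (hc.stronglyMeasurableAtFilter _ _) hc.continuousAt
    simpa using this
  have h2 := h1.comp_const_add z.1 0
  refine h2.congr_of_eventuallyEq (Filter.Eventually.of_forall fun s => ?_)
  simp only [charIntegral, Prod.fst_add, Prod.snd_add, Prod.smul_fst, Prod.smul_snd, smul_eq_mul,
    mul_one]
  refine intervalIntegral.integral_congr fun τ _ => ?_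
  congr 2
  ring

theorem dirDeriv_travelling {a : ℝ → ℝ} (ha : ContDiff ℝ ∞ a) (ε δ : ℝ) :
    dirDeriv (1, δ) (fun z => a (z.2 + ε * z.1)) = fun z => (δ + ε) * deriv a (z.2 + ε * z.1) := by
  ext z
  refine dirDeriv_eq_of_hasDerivAt (ha.comp (by fun_prop)) ?_
  have h1 : HasDerivAt a (deriv a (z.2 + ε * z.1))
      ((z + (0 : ℝ) • ((1, δ) : ℝ × ℝ)).2 + ε * (z + (0 : ℝ) • ((1, δ) : ℝ × ℝ)).1) := by
    simpa using ((ha.differentiable (by simp)) (z.2 + ε * z.1)).hasDerivAt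
  have h2 : HasDerivAt (fun s : ℝ => (z + s • ((1, δ) : ℝ × ℝ)).2 +
      ε * (z + s • ((1, δ) : ℝ × ℝ)).1) (δ + ε) 0 := by
    have := (((hasDerivAt_id (0 : ℝ)).mul_const δ).const_add z.2).add
      (((hasDerivAt_id (0 : ℝ)).const_add z.1).const_mul ε)
    simp only [one_mul, mul_one] at this
    refine this.congr_of_eventuallyEq (Filter.Eventually.of_forall fun s => ?_)
    simp
  rw [mul_comm]
  exact h1.comp 0 h2

section MildSolution
variable {a b G : ℝ → ℝ} {u : ℝ × ℝ → ℝ} (ha : ContDiff ℝ ∞ a) (hb : ContDiff ℝ ∞ b)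
  (hI : ∀ ε : ℝ, |ε| ≤ 1 → ContDiff ℝ ∞ (charIntegral ε (G ∘ u)))
  (heq : ∀ z, u z = a (z.2 + z.1) + b (z.2 - z.1) -
        1 / 2 * (charIntegral 1 (G ∘ u) z + charIntegral (-1) (G ∘ u) z))
include ha hb hI heq

theorem dirDeriv_mild (w : ℝ × ℝ) : dirDeriv w u = fun z =>
    (dirDeriv w (fun z => a (z.2 + 1 * z.1)) z + 1 * dirDeriv w (fun z => b (z.2 + (-1) * z.1)) z) +
      -(1 / 2) * (dirDeriv w (charIntegral 1 (G ∘ u)) z +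
        1 * dirDeriv w (charIntegral (-1) (G ∘ u)) z) := by
  have hA : ContDiff ℝ ∞ fun z : ℝ × ℝ => a (z.2 + 1 * z.1) := ha.comp (by fun_prop)
  have hB : ContDiff ℝ ∞ fun z : ℝ × ℝ => b (z.2 + (-1) * z.1) := hb.comp (by fun_prop)
  have hI1 := hI 1 (by simp)
  have hI2 := hI (-1) (by simp)
  have h : u = fun z : ℝ × ℝ => (a (z.2 + 1 * z.1) + 1 * b (z.2 + (-1) * z.1)) +
      -(1 / 2) * (charIntegral 1 (G ∘ u) z + 1 * charIntegral (-1) (G ∘ u) z) := by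
    ext z
    rw [heq z]
    ring_nf
  conv_lhs => rw [h]
  rw [dirDeriv_lincomb (hA.add (contDiff_const.mul hB)) (hI1.add (contDiff_const.mul hI2)),
    dirDeriv_lincomb hA hB, dirDeriv_lincomb hI1 hI2]

variable (hG : ContDiff ℝ ∞ G) (hu : ContDiff ℝ ∞ u)
include hG hu

theorem dirDeriv_null_null_mild (z : ℝ × ℝ) :
    dirDeriv (1, 1) (dirDeriv (1, -1) u) z = -(deriv G (u z) * dirDeriv (1, 0) u z) := by
  have hB : ContDiff ℝ ∞ fun z : ℝ × ℝ => b (z.2 + (-1) * z.1) := hb.comp (by fun_prop)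
  have hh : ContDiff ℝ ∞ (G ∘ u) := hG.comp hu
  have hI1 := hI 1 (by simp)
  have hI2 := hI (-1) (by simp)
  have d1 := dirDeriv_charIntegral hh.continuous hI1
  have d2 := dirDeriv_charIntegral hh.continuous hI2
  rw [neg_neg] at d2
  have hzero : ContDiff ℝ ∞ fun _ : ℝ × ℝ => (0 : ℝ) := contDiff_const
  have hz (w : ℝ × ℝ) : dirDeriv w (fun _ => (0 : ℝ)) = fun _ => 0 := by
    ext z; simp [dirDeriv]
  rw [dirDeriv_mild ha hb hI heq, dirDeriv_travelling ha, d1]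
  simp only [neg_add_cancel, zero_mul]
  rw [dirDeriv_lincomb (hzero.add (contDiff_const.mul (hB.dirDeriv _)))
      (hh.add (contDiff_const.mul (hI2.dirDeriv _))),
    dirDeriv_lincomb hzero (hB.dirDeriv _), dirDeriv_lincomb hh (hI2.dirDeriv _),
    dirDeriv_comm hB, dirDeriv_comm hI2, d2, dirDeriv_travelling hb]
  simp only [add_neg_cancel, zero_mul, hz]
  rw [dirDeriv_one_eq 1, dirDeriv_one_eq (-1)]
  have hchain : dirDeriv (1, 0) (G ∘ u) z = deriv G (u z) * dirDeriv (1, 0) u z := by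
    have h1 := ((hG.differentiable (by simp)) (u z)).hasDerivAt
    have h2 := ((hu.differentiable (by simp)) z).hasFDerivAt
    rw [dirDeriv, (h1.comp_hasFDerivAt z h2).fderiv]
    rfl
  rw [← hchain]
  ring

theorem dirDeriv_mild_initial (x : ℝ) :
    dirDeriv (1, 0) u (0, x) = deriv a x - deriv b x - G (u (0, x)) := by
  have hh : ContDiff ℝ ∞ (G ∘ u) := hG.comp hu
  have hI' (ε : ℝ) (hε : |ε| ≤ 1) : dirDeriv (1, 0) (charIntegral ε (G ∘ u)) (0, x) =
      G (u (0, x)) := by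
    have h1 := congrFun (dirDeriv_charIntegral hh.continuous (hI ε hε)) (0, x)
    rw [dirDeriv_one_eq] at h1
    have h2 : dirDeriv (0, 1) (charIntegral ε (G ∘ u)) (0, x) = 0 := by
      refine dirDeriv_eq_of_hasDerivAt (hI ε hε) ?_
      simpa [charIntegral] using hasDerivAt_const (0 : ℝ) (0 : ℝ)
    simpa [h2] using h1
  rw [dirDeriv_mild ha hb hI heq, dirDeriv_travelling ha, dirDeriv_travelling hb]
  simp only [hI' 1 (by simp), hI' (-1) (by simp)]
  ring_nf

end MildSolution

theorem dirDeriv_mul {f g : ℝ × ℝ → ℝ} (hf : ContDiff ℝ ∞ f) (hg : ContDiff ℝ ∞ g) (w z : ℝ × ℝ) :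
    dirDeriv w (fun z => f z * g z) z = f z * dirDeriv w g z + g z * dirDeriv w f z := by
  have h1 := ((hf.differentiable (by simp)) z).hasFDerivAt
  have h2 := ((hg.differentiable (by simp)) z).hasFDerivAt
  have h3 : HasFDerivAt (fun z => f z * g z) (f z • fderiv ℝ g z + g z • fderiv ℝ f z) z :=
    h1.mul h2
  rw [dirDeriv, h3.fderiv]
  rfl

theorem hasDerivAt_time {f : ℝ × ℝ → ℝ} (hf : ContDiff ℝ ∞ f) (t x : ℝ) :
    HasDerivAt (fun s => f (s, x)) (dirDeriv (1, 0) f (t, x)) t :=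
  (((hf.differentiable (by simp)) (t, x)).hasFDerivAt).comp_hasDerivAt t
    ((hasDerivAt_id t).prodMk (hasDerivAt_const t x))

theorem hasDerivAt_space {f : ℝ × ℝ → ℝ} (hf : ContDiff ℝ ∞ f) (t x : ℝ) :
    HasDerivAt (fun y => f (t, y)) (dirDeriv (0, 1) f (t, x)) x :=
  (((hf.differentiable (by simp)) (t, x)).hasFDerivAt).comp_hasDerivAt x
    ((hasDerivAt_const x t).prodMk (hasDerivAt_id x))

/-- Differentiation under the integral sign over a compact interval. -/
theorem hasDerivAt_intervalIntegral_time {f : ℝ × ℝ → ℝ} (hf : ContDiff ℝ ∞ f) (a b t : ℝ) :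
    HasDerivAt (fun s => ∫ x in a..b, f (s, x)) (∫ x in a..b, dirDeriv (1, 0) f (t, x)) t := by
  have hc := hf.continuous
  have hd := (hf.dirDeriv (1, 0)).continuous
  obtain ⟨C, hC⟩ := ((isCompact_closedBall t 1).prod
    (isCompact_uIcc (a := a) (b := b))).exists_bound_of_continuousOn hd.continuousOn
  refine (intervalIntegral.hasDerivAt_integral_of_dominated_loc_of_deriv_le
    (F := fun s x => f (s, x)) (F' := fun s x => dirDeriv (1, 0) f (s, x)) (bound := fun _ => C)
    (Metric.ball_mem_nhds t one_pos)
    (Filter.Eventually.of_forall fun s => ?_) ?_ ?_ ?_ ?_ ?_).2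
  · exact (by fun_prop : Continuous fun x => f (s, x)).aestronglyMeasurable
  · exact (by fun_prop : Continuous fun x => f (t, x)).intervalIntegrable _ _
  · exact (by fun_prop : Continuous fun x => dirDeriv (1, 0) f (t, x)).aestronglyMeasurable
  · exact Filter.Eventually.of_forall fun x hx s hs =>
      hC (s, x) ⟨Metric.ball_subset_closedBall hs, uIoc_subset_uIcc hx⟩
  · exact intervalIntegrable_const
  · exact Filter.Eventually.of_forall fun x _ s _ => hasDerivAt_time hf s x

/-- A priori sup bound by the initial energy for a linear wave equation with nonnegative
damping and Dirichlet conditions on `[0,1]`. -/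
theorem abs_le_of_damped_wave {u γ : ℝ × ℝ → ℝ} (hu : ContDiff ℝ ∞ u) (hγ : ∀ z, 0 ≤ γ z)
    (hwave : ∀ z, dirDeriv (1, 0) (dirDeriv (1, 0) u) z - dirDeriv (0, 1) (dirDeriv (0, 1) u) z =
      -(γ z * dirDeriv (1, 0) u z))
    (h0 : ∀ t, u (t, 0) = 0) (h1 : ∀ t, u (t, 1) = 0) {t x : ℝ} (ht : 0 ≤ t)
    (hx : x ∈ Icc (0 : ℝ) 1) :
    |u (t, x)| ≤ 1 / 2 + ∫ y in (0 : ℝ)..1,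
      1 / 2 * (dirDeriv (0, 1) u (0, y) ^ 2 + dirDeriv (1, 0) u (0, y) ^ 2) := by
  set v := dirDeriv (1, 0) u with hv
  set w := dirDeriv (0, 1) u with hw
  have hvs : ContDiff ℝ ∞ v := hu.dirDeriv _
  have hws : ContDiff ℝ ∞ w := hu.dirDeriv _
  have hwc := hws.continuous
  have hvc := hvs.continuous
  have hvb (c : ℝ) (hc : ∀ t, u (t, c) = 0) (t : ℝ) : v (t, c) = 0 := by
    have h := hasDerivAt_time hu t c
    simp only [hc] at h
    exact h.unique (hasDerivAt_const t 0)
  set e : ℝ × ℝ → ℝ := fun z => 1 / 2 * (w z ^ 2 + v z ^ 2) with he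
  have hes : ContDiff ℝ ∞ e := contDiff_const.mul ((hws.pow 2).add (hvs.pow 2))
  have hdens (z : ℝ × ℝ) : dirDeriv (1, 0) e z =
      dirDeriv (0, 1) (fun z => w z * v z) z - γ z * v z ^ 2 := by
    have hee : e = fun z => (1 / 2 * (w z * w z)) + 1 / 2 * (v z * v z) := by
      ext z; simp only [he]; ring
    have hsc {f : ℝ × ℝ → ℝ} (hf : ContDiff ℝ ∞ f) :
        dirDeriv (1, 0) (fun z => 1 / 2 * (f z * f z)) z = f z * dirDeriv (1, 0) f z := by
      rw [dirDeriv_mul contDiff_const (hf.mul hf), dirDeriv_mul hf hf]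
      simp [dirDeriv]
      ring
    have hadd := congrFun (dirDeriv_lincomb (contDiff_const (c := (1 / 2 : ℝ)) |>.mul (hws.mul hws))
      (contDiff_const (c := (1 / 2 : ℝ)) |>.mul (hvs.mul hvs)) 1 (1, 0)) z
    simp only [one_mul] at hadd
    have hcomm : dirDeriv (1, 0) w = dirDeriv (0, 1) v := dirDeriv_comm hu _ _
    rw [hee, hadd, hsc hws, hsc hvs, dirDeriv_mul hws hvs, hcomm]
    linear_combination v z * hwave z
  have hderiv (s : ℝ) : HasDerivAt (fun s => ∫ y in (0 : ℝ)..1, e (s, y))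
      (∫ y in (0 : ℝ)..1, dirDeriv (1, 0) e (s, y)) s := hasDerivAt_intervalIntegral_time hes 0 1 s
  have hec := hes.continuous
  have hle (s : ℝ) : ∫ y in (0 : ℝ)..1, dirDeriv (1, 0) e (s, y) ≤ 0 := by
    have hwv := hws.mul hvs
    have hflux : ∫ y in (0 : ℝ)..1, dirDeriv (0, 1) (fun z => w z * v z) (s, y) = 0 := by
      have hc := (hwv.dirDeriv (0, 1)).continuous
      have hc' : Continuous fun y => dirDeriv (0, 1) (fun z => w z * v z) (s, y) :=
        hc.comp (by fun_prop : Continuous fun y : ℝ => (s, y))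
      rw [intervalIntegral.integral_eq_sub_of_hasDerivAt
        (fun y _ => hasDerivAt_space hwv s y) (hc'.intervalIntegrable _ _)]
      simp [hvb 0 h0, hvb 1 h1]
    refine le_of_le_of_eq ?_ hflux
    have hslice {f : ℝ × ℝ → ℝ} (hf : ContDiff ℝ ∞ f) :
        IntervalIntegrable (fun y => f (s, y)) volume 0 1 :=
      (hf.continuous.comp (by fun_prop : Continuous fun y : ℝ => (s, y))).intervalIntegrable _ _
    refine intervalIntegral.integral_mono_on zero_le_one (hslice (hes.dirDeriv (1, 0)))
      (hslice (hwv.dirDeriv (0, 1))) fun y _ => ?_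
    rw [hdens]
    exact sub_le_self _ (mul_nonneg (hγ _) (sq_nonneg _))
  have hanti : Antitone fun s => ∫ y in (0 : ℝ)..1, e (s, y) :=
    antitone_of_hasDerivAt_nonpos hderiv hle
  have hws' : Continuous fun y => w (t, y) := by fun_prop
  have hftc : u (t, x) = ∫ y in (0 : ℝ)..x, w (t, y) := by
    rw [intervalIntegral.integral_eq_sub_of_hasDerivAt (fun y _ => hasDerivAt_space hu t y)
      (hws'.intervalIntegrable _ _), h0, sub_zero]
  calc |u (t, x)| ≤ ∫ y in (0 : ℝ)..x, |w (t, y)| := by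
        rw [hftc]; exact intervalIntegral.abs_integral_le_integral_abs hx.1
    _ ≤ ∫ y in (0 : ℝ)..1, |w (t, y)| :=
        intervalIntegral.integral_mono_interval le_rfl hx.1 hx.2
          (Filter.Eventually.of_forall fun _ => abs_nonneg _) (hws'.abs.intervalIntegrable _ _)
    _ ≤ ∫ y in (0 : ℝ)..1, (1 / 2 + e (t, y)) := by
        refine intervalIntegral.integral_mono_on zero_le_one (hws'.abs.intervalIntegrable _ _)
          ((by fun_prop : Continuous fun y => 1 / 2 + e (t, y)).intervalIntegrable _ _)
          fun y _ => ?_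
        simp only [he]
        nlinarith [sq_nonneg (|w (t, y)| - 1), sq_abs (w (t, y)), sq_nonneg (v (t, y))]
    _ = 1 / 2 + ∫ y in (0 : ℝ)..1, e (t, y) := by
        rw [intervalIntegral.integral_add intervalIntegrable_const
          ((by fun_prop : Continuous fun y => e (t, y)).intervalIntegrable _ _)]
        simp
    _ ≤ 1 / 2 + ∫ y in (0 : ℝ)..1, e (0, y) := by gcongr; exact hanti ht

/-- A smooth, odd, Lipschitz, nondecreasing primitive agreeing with the primitive of
`α s ^ (2 * m)` on `[-R, R]`. -/
theorem exists_truncated_damping {α : ℝ} (hα : 0 ≤ α) (m : ℕ) {R : ℝ} (hR : 0 < R) :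
    ∃ G : ℝ → ℝ, ContDiff ℝ ∞ G ∧ (∃ C : NNReal, LipschitzWith C G) ∧ (∀ s, G (-s) = -G s) ∧
      (∀ s, 0 ≤ deriv G s) ∧ ∀ s, |s| ≤ R → deriv G s = α * s ^ (2 * m) := by
  let χ : ContDiffBump (0 : ℝ) := ⟨R, R + 1, hR, by linarith⟩
  set g : ℝ → ℝ := fun s => α * s ^ (2 * m) * χ s with hg
  have hgs : ContDiff ℝ ∞ g := (contDiff_const.mul (contDiff_id.pow _)).mul χ.contDiff
  have hgc := hgs.continuous
  have hd (s : ℝ) : HasDerivAt (fun s => ∫ τ in (0 : ℝ)..s, g τ) (g s) s :=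
    intervalIntegral.integral_hasDerivAt_right (hgc.intervalIntegrable _ _)
      (hgc.stronglyMeasurableAtFilter _ _) hgc.continuousAt
  have hderiv : deriv (fun s => ∫ τ in (0 : ℝ)..s, g τ) = g := funext fun s => (hd s).deriv
  have hgsupp : HasCompactSupport g := χ.hasCompactSupport.mul_left
  obtain ⟨C, hC⟩ := hgc.bounded_above_of_compact_support hgsupp
  have hgeven (s : ℝ) : g (-s) = g s := by
    simp only [hg, χ.neg, Even.neg_pow (even_two_mul m)]
  refine ⟨fun s => ∫ τ in (0 : ℝ)..s, g τ, ?_, ⟨C.toNNReal, ?_⟩, fun s => ?_, fun s => ?_,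
    fun s hs => ?_⟩
  · exact contDiff_infty_iff_deriv.2 ⟨fun s => (hd s).differentiableAt, by rwa [hderiv]⟩
  · refine lipschitzWith_of_nnnorm_deriv_le (fun s => (hd s).differentiableAt) fun s => ?_
    rw [hderiv, ← NNReal.coe_le_coe, coe_nnnorm]
    exact (hC s).trans (le_coe_toNNReal C)
  · have := intervalIntegral.integral_comp_neg (a := 0) (b := s) g
    simp only [hgeven, neg_zero] at this
    simp only [this]
    exact intervalIntegral.integral_symm _ _
  · rw [hderiv]
    exact mul_nonneg (mul_nonneg hα (Even.pow_nonneg (even_two_mul m) s)) χ.nonneg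
  · rw [hderiv, hg]
    simp only
    rw [χ.one_of_mem_closedBall (by simpa using hs), mul_one]

/-- The reflected extension across `0` of a function on the half-line, with sign `ε`. -/
noncomputable def reflectExtend (ε : ℝ) (f : ℝ → ℝ) (y : ℝ) : ℝ :=
  if 0 ≤ y then f y else ε * f (-y)

theorem hasDerivAt_reflectExtend {ε : ℝ} {f : ℝ → ℝ} (hf : Differentiable ℝ f)
    (hf' : Continuous (deriv f)) (h0 : f 0 = ε * f 0) (h1 : deriv f 0 = -ε * deriv f 0) (y : ℝ) :
    HasDerivAt (reflectExtend ε f) (reflectExtend (-ε) (deriv f) y) y := by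
  have hcont {δ : ℝ} {g : ℝ → ℝ} (hg : Continuous g) (hg0 : g 0 = δ * g 0) :
      Continuous (reflectExtend δ g) := by
    refine Continuous.if_le hg (by fun_prop) continuous_const continuous_id fun y hy => ?_
    rw [← hy, neg_zero]; exact hg0
  have hne (y : ℝ) (hy : y ≠ 0) :
      HasDerivAt (reflectExtend ε f) (reflectExtend (-ε) (deriv f) y) y := by
    rcases hy.lt_or_gt with hy | hy
    · have h : HasDerivAt (fun y => ε * f (-y)) (-ε * deriv f (-y)) y := by
        have := ((hf (-y)).hasDerivAt.comp y (hasDerivAt_neg y)).const_mul ε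
        convert! this using 1
        ring
      rw [reflectExtend, if_neg (not_le.2 hy)]
      refine h.congr_of_eventuallyEq ?_
      filter_upwards [eventually_lt_nhds hy] with z hz
      simp [reflectExtend, not_le.2 hz]
    · rw [reflectExtend, if_pos hy.le]
      refine (hf y).hasDerivAt.congr_of_eventuallyEq ?_
      filter_upwards [eventually_gt_nhds hy] with z hz
      simp [reflectExtend, hz.le]
  by_cases hy : y = 0
  · subst hy
    exact hasDerivAt_of_hasDerivAt_of_ne' hne (hcont hf.continuous h0).continuousAt
      (hcont hf' h1).continuousAt 0
  · exact hne y hy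

theorem contDiff_reflectExtend {ε : ℝ} {f : ℝ → ℝ} (hf : ContDiff ℝ ∞ f)
    (h : ∀ j, iteratedDeriv j f 0 = ε * (-1) ^ j * iteratedDeriv j f 0) :
    ContDiff ℝ ∞ (reflectExtend ε f) := by
  refine contDiff_infty.2 fun n => ?_
  induction n generalizing ε f with
  | zero =>
    have hd := hasDerivAt_reflectExtend (ε := ε) (hf.differentiable (by simp))
      (hf.continuous_deriv (by simp)) (by simpa using h 0) (by simpa using h 1)
    exact contDiff_zero.2 (Differentiable.continuous fun y => (hd y).differentiableAt)
  | succ n ih =>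
    have hd := hasDerivAt_reflectExtend (ε := ε) (hf.differentiable (by simp))
      (hf.continuous_deriv (by simp)) (by simpa using h 0) (by simpa using h 1)
    have hderiv : deriv (reflectExtend ε f) = reflectExtend (-ε) (deriv f) :=
      funext fun y => (hd y).deriv
    refine (contDiff_succ_iff_deriv (n := n)).2
      ⟨fun y => (hd y).differentiableAt, by simp, ?_⟩
    rw [hderiv]
    refine ih (contDiff_infty_iff_deriv.1 hf).2 fun j => ?_
    have := h (j + 1)
    rw [iteratedDeriv_succ', pow_succ] at this
    linear_combination this

/-- Smooth functions on `[0,1]` whose even-order derivatives vanish at the endpoints extend to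
smooth functions on the line that are odd about both endpoints. -/
theorem exists_odd_extension {f : ℝ → ℝ} (hf : ContDiff ℝ ∞ f)
    (h : ∀ j : ℕ, iteratedDeriv (2 * j) f 0 = 0 ∧ iteratedDeriv (2 * j) f 1 = 0) :
    ∃ e : ℝ → ℝ, ContDiff ℝ ∞ e ∧ (∀ x, e (-x) = -e x) ∧ (∀ x, e (2 - x) = -e x) ∧
      ∀ x ∈ Icc (0 : ℝ) 1, e x = f x := by
  have hf0 : f 0 = 0 := by simpa using (h 0).1
  have hf1 : f 1 = 0 := by simpa using (h 0).2
  set f' : ℝ → ℝ := fun y => f (1 - y) with hf'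
  have hS : ContDiff ℝ ∞ (reflectExtend (-1) f) := by
    refine contDiff_reflectExtend hf fun j => ?_
    rcases Nat.even_or_odd' j with ⟨k, rfl | rfl⟩
    · simp [(h k).1]
    · simp [pow_succ]
  have hS' : ContDiff ℝ ∞ (reflectExtend (-1) f') := by
    refine contDiff_reflectExtend (hf.comp (by fun_prop)) fun j => ?_
    rw [hf', iteratedDeriv_comp_const_sub]
    rcases Nat.even_or_odd' j with ⟨k, rfl | rfl⟩
    · simp [(h k).2]
    · simp [pow_succ]
  set e : ℝ → ℝ := fun x => if Even ⌊x⌋ then f (x - ⌊x⌋) else -f (⌊x⌋ + 1 - x) with he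
  have hfloor (n : ℤ) (x : ℝ) (h1 : (n : ℝ) ≤ x) (h2 : x < n + 1) : ⌊x⌋ = n :=
    Int.floor_eq_iff.2 ⟨h1, h2⟩
  have hval (n : ℤ) (x : ℝ) (h1 : (n : ℝ) ≤ x) (h2 : x ≤ n + 1) :
      e x = if Even n then f (x - n) else -f (n + 1 - x) := by
    rcases h2.lt_or_eq with h2 | rfl
    · simp only [he, hfloor n x h1 h2]
    · have : ⌊(n : ℝ) + 1⌋ = n + 1 := by simp
      simp only [he, this, Int.even_add_one]
      by_cases hn : Even n <;> simp [hn, hf0, hf1]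
  refine ⟨e, ?_, fun x => ?_, fun x => ?_, fun x hx => ?_⟩
  · refine contDiff_iff_contDiffAt.2 fun x => ?_
    set n := round x with hn
    have hx := abs_le.1 (abs_sub_round x)
    have hnear : ∀ᶠ y in 𝓝 x, (n : ℝ) - 1 ≤ y ∧ y ≤ n + 1 := by
      filter_upwards [eventually_gt_nhds (show (n : ℝ) - 1 < x by linarith [hx.1]),
        eventually_lt_nhds (show x < (n : ℝ) + 1 by linarith [hx.2])] with y h1 h2
      exact ⟨h1.le, h2.le⟩
    by_cases hev : Even n
    · refine (hS.comp (contDiff_id.sub contDiff_const : ContDiff ℝ ∞ fun y : ℝ => y - n)).contDiffAt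
        |>.congr_of_eventuallyEq ?_
      filter_upwards [hnear] with y hy
      simp only [Function.comp_apply, reflectExtend, id_eq]
      split_ifs with hyn
      · rw [hval n y (by linarith) hy.2, if_pos hev]
      · rw [hval (n - 1) y (by push_cast; linarith) (by push_cast; linarith),
          if_neg (by simp [hev])]
        push_cast
        ring_nf
    · refine (hS'.comp (contDiff_id.sub contDiff_const :
        ContDiff ℝ ∞ fun y : ℝ => y - n)).neg.contDiffAt |>.congr_of_eventuallyEq ?_
      filter_upwards [hnear] with y hy
      simp only [Function.comp_apply, reflectExtend, hf', id_eq]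
      split_ifs with hyn
      · rw [hval n y (by linarith) hy.2, if_neg hev]
        ring_nf
      · rw [hval (n - 1) y (by push_cast; linarith) (by push_cast; linarith),
          if_pos (by simpa [Int.even_sub_one] using hev)]
        push_cast
        ring_nf
  · have h1 := Int.floor_le x
    have h2 := (Int.lt_floor_add_one x).le
    rw [hval (-⌊x⌋ - 1) (-x) (by push_cast; linarith) (by push_cast; linarith), hval ⌊x⌋ x h1 h2]
    by_cases hn : Even ⌊x⌋ <;> simp only [Int.even_sub_one, even_neg, hn, not_true, not_false_iff,
      if_true, if_false] <;> push_cast <;> ring_nf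
  · have h1 := Int.floor_le x
    have h2 := (Int.lt_floor_add_one x).le
    rw [hval (1 - ⌊x⌋) (2 - x) (by push_cast; linarith) (by push_cast; linarith), hval ⌊x⌋ x h1 h2]
    have : Even (1 - ⌊x⌋) ↔ ¬ Even ⌊x⌋ := by grind
    by_cases hn : Even ⌊x⌋ <;> simp only [this, hn, not_true, not_false_iff,
      if_true, if_false] <;> push_cast <;> ring_nf
  · rw [hval 0 x (by simpa using hx.1) (by simpa using hx.2)]
    simp

/-- Travelling profiles realizing odd Cauchy data for the damped wave equation in mild form. -/
theorem exists_travelling_profiles {v₀ v₁ G : ℝ → ℝ} (hv₀ : ContDiff ℝ ∞ v₀)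
    (hv₁ : ContDiff ℝ ∞ v₁) (hG : ContDiff ℝ ∞ G) (hodd : ∀ s, G (-s) = -G s) :
    ∃ a b : ℝ → ℝ, ContDiff ℝ ∞ a ∧ ContDiff ℝ ∞ b ∧ (∀ x, a x + b x = v₀ x) ∧
      (∀ x, deriv a x - deriv b x = v₁ x + G (v₀ x)) ∧
      ∀ c, (∀ s, v₀ (2 * c - s) = -v₀ s) → (∀ s, v₁ (2 * c - s) = -v₁ s) →
        ∀ s, b (2 * c - s) = -a s := by
  set h : ℝ → ℝ := fun x => v₁ x + G (v₀ x) with hh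
  have hhs : ContDiff ℝ ∞ h := hv₁.add (hG.comp hv₀)
  have hhc := hhs.continuous
  set P : ℝ → ℝ := fun x => ∫ y in (0 : ℝ)..x, h y with hP
  have hd (x : ℝ) : HasDerivAt P (h x) x :=
    intervalIntegral.integral_hasDerivAt_right (hhc.intervalIntegrable _ _)
      (hhc.stronglyMeasurableAtFilter _ _) hhc.continuousAt
  have hPs : ContDiff ℝ ∞ P := contDiff_infty_iff_deriv.2
    ⟨fun x => (hd x).differentiableAt, by rwa [show deriv P = h from funext fun x => (hd x).deriv]⟩
  have hd₀ (x : ℝ) : HasDerivAt v₀ (deriv v₀ x) x :=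
    (hv₀.differentiable (by simp) x).hasDerivAt
  have hda (x : ℝ) : HasDerivAt (fun x => 1 / 2 * (v₀ x + P x)) (1 / 2 * (deriv v₀ x + h x)) x :=
    ((hd₀ x).add (hd x)).const_mul _
  have hdb (x : ℝ) : HasDerivAt (fun x => 1 / 2 * (v₀ x - P x)) (1 / 2 * (deriv v₀ x - h x)) x :=
    ((hd₀ x).sub (hd x)).const_mul _
  refine ⟨fun x => 1 / 2 * (v₀ x + P x), fun x => 1 / 2 * (v₀ x - P x),
    contDiff_const.mul (hv₀.add hPs), contDiff_const.mul (hv₀.sub hPs), fun x => ?_, fun x => ?_, fun c h₀ h₁ s => ?_⟩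
  · ring
  · rw [(hda x).deriv, (hdb x).deriv]
    ring
  · have hrefl (x : ℝ) : HasDerivAt (fun x => P (2 * c - x) - P x) 0 x := by
      have h1 := ((hd (2 * c - x)).comp_const_sub (2 * c) x).sub (hd x)
      have h2 : -h (2 * c - x) - h x = 0 := by
        simp only [hh, h₀, h₁, hodd]
        ring
      rwa [h2] at h1
    have hconst := is_const_of_deriv_eq_zero (fun x => (hrefl x).differentiableAt)
      (fun x => (hrefl x).deriv) s c
    have : P (2 * c - s) = P s := by
      simp only [show 2 * c - c = c by ring, sub_self] at hconst
      linarith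
    simp only [h₀, this]
    ring

/-- Global existence of smooth solutions for smooth compatible data: if all even-order
derivatives of the smooth data vanish at the endpoints, there is a jointly smooth global
classical solution of the degenerately damped wave equation attaining the data. -/
theorem global_existence_smooth
    (α : ℝ) (hα : 0 < α) (m : ℕ) (hm : 1 ≤ m)
    (u₀ u₁ : ℝ → ℝ)
    (h₀ : ∀ n : ℕ, ContDiff ℝ n u₀) (h₁ : ∀ n : ℕ, ContDiff ℝ n u₁)
    (hc₀ : ∀ j : ℕ, iteratedDeriv (2*j) u₀ 0 = 0 ∧ iteratedDeriv (2*j) u₀ 1 = 0)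
    (hc₁ : ∀ j : ℕ, iteratedDeriv (2*j) u₁ 0 = 0 ∧ iteratedDeriv (2*j) u₁ 1 = 0) :
    ∃ u : ℝ → ℝ → ℝ,
      (∀ n : ℕ, ContDiff ℝ n (Function.uncurry u)) ∧
      (∀ T : ℝ, 0 < T → IsClassicalSolution α m T u) ∧
      (∀ x ∈ Icc (0:ℝ) 1, u 0 x = u₀ x ∧ pdt u 0 x = u₁ x) := by
  obtain ⟨v₀, hv₀, ho₀, ho₀', he₀⟩ := exists_odd_extension (contDiff_infty.2 h₀) hc₀
  obtain ⟨v₁, hv₁, ho₁, ho₁', he₁⟩ := exists_odd_extension (contDiff_infty.2 h₁) hc₁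
  set R : ℝ := 1 / 2 + ∫ y in (0 : ℝ)..1, 1 / 2 * (deriv v₀ y ^ 2 + v₁ y ^ 2) with hRdef
  have hR : 0 < R := add_pos_of_pos_of_nonneg (by norm_num)
    (intervalIntegral.integral_nonneg zero_le_one fun y _ => by positivity)
  obtain ⟨G, hG, ⟨C, hGC⟩, hodd, hpos, hGR⟩ := exists_truncated_damping hα.le m hR
  obtain ⟨a, b, ha, hb, hab, hab', hrefl⟩ := exists_travelling_profiles hv₀ hv₁ hG hodd
  obtain ⟨u, hu, hI, heq, hsymm⟩ := exists_smooth_mild_solution ha hb hG hGC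
  have hb0 (t : ℝ) : u (t, 0) = 0 := by
    have := hsymm 0 (hrefl 0 (by simpa using ho₀) (by simpa using ho₁)) hodd t 0
    simp only [mul_zero, sub_zero] at this
    linarith
  have hb1 (t : ℝ) : u (t, 1) = 0 := by
    have := hsymm 1 (hrefl 1 (by simpa using ho₀') (by simpa using ho₁')) hodd t 1
    norm_num at this
    linarith
  have hu0 (x : ℝ) : u (0, x) = v₀ x := by
    rw [heq, ← hab]
    simp [charIntegral]
  have hut0 (x : ℝ) : dirDeriv (1, 0) u (0, x) = v₁ x := by
    rw [dirDeriv_mild_initial ha hb hI heq hG hu, hab', hu0]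
    ring
  have hux0 (x : ℝ) : dirDeriv (0, 1) u (0, x) = deriv v₀ x := by
    rw [← (hasDerivAt_space hu 0 x).deriv]
    simp only [hu0]
  have hwave (z : ℝ × ℝ) : dirDeriv (1, 0) (dirDeriv (1, 0) u) z -
      dirDeriv (0, 1) (dirDeriv (0, 1) u) z = -(deriv G (u z) * dirDeriv (1, 0) u z) := by
    rw [← dirDeriv_null_null hu, dirDeriv_null_null_mild ha hb hI heq hG hu]
  have hbound {t x : ℝ} (ht : 0 ≤ t) (hx : x ∈ Icc (0 : ℝ) 1) : |u (t, x)| ≤ R := by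
    have := abs_le_of_damped_wave (γ := fun z => deriv G (u z)) hu (fun z => hpos _) hwave hb0 hb1
      ht hx
    simpa only [hut0, hux0] using this
  refine ⟨Function.curry u, fun n => ?_, fun T _ => ⟨?_, fun t ht x hx => ?_, fun t _ => ?_⟩,
    fun x hx => ⟨?_, ?_⟩⟩
  · rw [Function.uncurry_curry]
    exact contDiff_infty.1 hu n
  · rw [Function.uncurry_curry]
    exact contDiff_infty.1 hu 2
  · rw [pdt_curry hu, pdt_curry (hu.dirDeriv _), pdx_curry hu, pdx_curry (hu.dirDeriv _)]
    simp only [Function.curry_apply]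
    rw [hwave, hGR _ (hbound ht.1 hx)]
    ring
  · exact ⟨hb0 t, hb1 t⟩
  · rw [Function.curry_apply, hu0, he₀ x hx]
  · rw [pdt_curry hu, Function.curry_apply, hut0, he₁ x hx]
end
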